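/- arXiv:2512.09308 — 2 statements merged into one kernel-verified Lean document; each statement's English description precedes it below -/
import Mathlib

section
/- Assume A_0 = 0, α > 1/2, β ∈ (0,1), γ > 0, μ > 0, t > 0, and let δ ∈ (β/(2α²), β/α). Then lim_{ε→0⁺} ∫_{|λ| ≤ ε^{−δ}} E_β²(−μ|λ|^α (1 + λ² ε^{2β/α})^{γ/2} t^β) f(ε^{β/α} λ) dλ = f(0) ∫_ℝ E_β²(−μ|λ|^α t^β) dλ, where f(0) = ∑_{j=1}^n A_j c_1(κ_j) K_{(κ_j−1)/2}(w_j) w_j^{(κ_j−1)/2}. -/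
open Real Filter Topology MeasureTheory

/-- The modified Bessel function of the second kind
`K_ν(z) = (1/2) ∫_0^∞ s^{ν−1} exp(−(z/2)(s + 1/s)) ds`. -/
noncomputable def besselK (ν z : ℝ) : ℝ :=
  (1 / 2) * ∫ s in Set.Ioi (0 : ℝ), s ^ (ν - 1) * Real.exp (-(z / 2) * (s + 1 / s))

/-- The spectral density
`f(λ) = (c_1(κ_0)/2) A_0 K_{(κ_0−1)/2}(|λ|)|λ|^{(κ_0−1)/2}
  + ∑_{j=1}^n (c_1(κ_j)/2) A_j (K_{(κ_j−1)/2}(|λ+w_j|)|λ+w_j|^{(κ_j−1)/2}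
                              + K_{(κ_j−1)/2}(|λ−w_j|)|λ−w_j|^{(κ_j−1)/2})`,
with `c_1(κ_0) = 2·2^{(1−κ_0)/2}/(√π Γ(κ_0/2))` and
`c_1(κ_j) = 2^{(1−κ_j)/2}/(√π Γ(κ_j/2))` for `j ≥ 1`. -/
noncomputable def specDensity (n : ℕ) (w κ A : ℕ → ℝ) (lam : ℝ) : ℝ :=
  2 * (2 : ℝ) ^ ((1 - κ 0) / 2) / (Real.sqrt Real.pi * Real.Gamma (κ 0 / 2)) / 2 * A 0 *
      besselK ((κ 0 - 1) / 2) |lam| * |lam| ^ ((κ 0 - 1) / 2) +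
    ∑ j ∈ Finset.Icc 1 n,
      (2 : ℝ) ^ ((1 - κ j) / 2) / (Real.sqrt Real.pi * Real.Gamma (κ j / 2)) / 2 * A j *
        (besselK ((κ j - 1) / 2) |lam + w j| * |lam + w j| ^ ((κ j - 1) / 2) +
          besselK ((κ j - 1) / 2) |lam - w j| * |lam - w j| ^ ((κ j - 1) / 2))

/-- The Mittag-Leffler function `E_β(s) = ∑_{k=0}^∞ s^k / Γ(1 + βk)`. -/
noncomputable def mittagLeffler (β s : ℝ) : ℝ := ∑' k : ℕ, s ^ k / Real.Gamma (1 + β * k)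

/-- The value `f(0) = ∑_{j=1}^n A_j c_1(κ_j) K_{(κ_j−1)/2}(w_j) w_j^{(κ_j−1)/2}` of the
spectral density at the origin when `A₀ = 0`. -/
noncomputable def specDensityZero (n : ℕ) (w κ A : ℕ → ℝ) : ℝ :=
  ∑ j ∈ Finset.Icc 1 n,
    A j * ((2 : ℝ) ^ ((1 - κ j) / 2) / (Real.sqrt Real.pi * Real.Gamma (κ j / 2))) *
      besselK ((κ j - 1) / 2) (w j) * (w j) ^ ((κ j - 1) / 2)


theorem gamma_lower {b R : ℝ} (hb : 0 < b) (hR : 0 < R) :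
    ∃ C : ℝ, 0 < C ∧ ∀ y : ℝ, 0 ≤ y → C * R ^ y ≤ Real.Gamma (b + y) := by
  have hint : ∀ y : ℝ, 0 ≤ y →
      IntegrableOn (fun x : ℝ => Real.exp (-x) * x ^ (b + y - 1)) (Set.Ioi 0) := fun y hy =>
    Real.GammaIntegral_convergent (by linarith)
  have hsub : Set.Ioi R ⊆ Set.Ioi (0 : ℝ) := Set.Ioi_subset_Ioi hR.le
  refine ⟨∫ x in Set.Ioi R, Real.exp (-x) * x ^ (b - 1), ?_, ?_⟩
  · have h0 := (hint 0 le_rfl).mono_set hsub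
    simp only [add_zero] at h0
    rw [setIntegral_pos_iff_support_of_nonneg_ae _ h0]
    · have : Set.Ioi R ⊆ (Function.support fun x : ℝ => Real.exp (-x) * x ^ (b - 1)) ∩ Set.Ioi R := by
        intro x hx
        refine ⟨?_, hx⟩
        have : 0 < x := hR.trans hx
        exact (by positivity : Real.exp (-x) * x ^ (b - 1) ≠ 0)
      refine lt_of_lt_of_le ?_ (measure_mono this)
      simp
    · refine (ae_restrict_iff' measurableSet_Ioi).2 (Eventually.of_forall fun x hx => ?_)
      have : 0 < x := hR.trans hx
      simp only [Pi.zero_apply]; positivity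
  · intro y hy
    have h0 := (hint 0 le_rfl).mono_set hsub
    simp only [add_zero] at h0
    rw [Real.Gamma_eq_integral (by linarith), ← integral_mul_const]
    refine le_trans (setIntegral_mono_on (h0.mul_const _) ((hint y hy).mono_set hsub)
      measurableSet_Ioi ?_) (setIntegral_mono_set (hint y hy) ?_ hsub.eventuallyLE)
    · intro x hx
      have hx0 : 0 < x := hR.trans hx
      rw [show b + y - 1 = (b - 1) + y by ring, Real.rpow_add hx0, ← mul_assoc]
      gcongr
      exact (Set.mem_Ioi.1 hx).le
    · refine (ae_restrict_iff' measurableSet_Ioi).2 (Eventually.of_forall fun x hx => ?_)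
      have : 0 < x := hx
      simp only [Pi.zero_apply]; positivity

/-- Two-parameter Mittag-Leffler function. -/
noncomputable def mlTwo (β b s : ℝ) : ℝ := ∑' k : ℕ, s ^ k / Real.Gamma (b + β * k)

theorem ml_bound {β b M : ℝ} (hβ : 0 < β) (hb : 0 < b) (hM : 0 < M) :
    ∃ C : ℝ, 0 < C ∧ ∀ (k : ℕ) (s : ℝ), |s| ≤ M →
      ‖s ^ k / Real.Gamma (b + β * k)‖ ≤ C * (1 / 2) ^ k := by
  have hR : 0 < (2 * M) ^ (1 / β) := by positivity
  obtain ⟨C, hC, h⟩ := gamma_lower hb hR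
  refine ⟨1 / C, by positivity, fun k s hs => ?_⟩
  have h1 := h (β * k) (by positivity)
  rw [← Real.rpow_mul (by positivity), show 1 / β * (β * k) = (k : ℝ) by field_simp,
    Real.rpow_natCast] at h1
  have hG : 0 < Real.Gamma (b + β * k) := Real.Gamma_pos_of_pos (by positivity)
  rw [norm_div, norm_pow, Real.norm_eq_abs, Real.norm_eq_abs, abs_of_pos hG]
  have h2 : |s| ^ k ≤ M ^ k := pow_le_pow_left₀ (abs_nonneg _) hs k
  calc |s| ^ k / Real.Gamma (b + β * k) ≤ M ^ k / (C * (2 * M) ^ k) := by gcongr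
    _ = 1 / C * (1 / 2) ^ k := by
      rw [mul_pow, div_pow, one_pow]; field_simp

theorem ml_geom (C : ℝ) : Summable fun k : ℕ => C * (1 / 2 : ℝ) ^ k :=
  (summable_geometric_of_lt_one (by norm_num) (by norm_num)).mul_left C

theorem mlTwo_summable {β b : ℝ} (hβ : 0 < β) (hb : 0 < b) (s : ℝ) :
    Summable fun k : ℕ => s ^ k / Real.Gamma (b + β * k) := by
  obtain ⟨C, hC, h⟩ := ml_bound hβ hb (M := |s| + 1) (by positivity)
  exact (ml_geom C).of_norm_bounded fun k => h k s (by linarith)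

theorem mlTwo_continuous {β b : ℝ} (hβ : 0 < β) (hb : 0 < b) : Continuous (mlTwo β b) := by
  rw [continuous_iff_continuousAt]
  intro s
  obtain ⟨C, hC, h⟩ := ml_bound hβ hb (M := |s| + 1) (by positivity)
  have : ContinuousOn (mlTwo β b) (Metric.ball 0 (|s| + 1)) := by
    refine continuousOn_tsum (fun k => by fun_prop) (ml_geom C) (fun k x hx => h k x ?_)
    simpa using (mem_ball_zero_iff.1 hx).le
  exact this.continuousAt (Metric.isOpen_ball.mem_nhds (by simp))

theorem ml_eq (β s : ℝ) : mittagLeffler β s = mlTwo β 1 s := rfl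

theorem ml_shift {β : ℝ} (hβ : 0 < β) (s : ℝ) :
    mittagLeffler β s = 1 + s * mlTwo β (1 + β) s := by
  rw [ml_eq, mlTwo, (mlTwo_summable hβ one_pos s).tsum_eq_zero_add, mlTwo, ← tsum_mul_left]
  congr 1
  · simp
  · refine tsum_congr fun k => ?_
    push_cast
    rw [show 1 + β * ((k : ℝ) + 1) = 1 + β + β * k by ring]
    ring

theorem ml_hasDerivAt {β : ℝ} (hβ : 0 < β) (s : ℝ) :
    HasDerivAt (mittagLeffler β) (mlTwo β β s / β) s := by
  obtain ⟨C, hC, h⟩ := ml_bound hβ hβ (M := |s| + 1) (by positivity)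
  have key : HasDerivAt (fun z : ℝ => ∑' k : ℕ, z ^ (k + 1) / Real.Gamma (1 + β * (k + 1 : ℕ)))
      (∑' k : ℕ, s ^ k / Real.Gamma (β + β * k) / β) s := by
    refine hasDerivAt_tsum_of_isPreconnected
      (g := fun (k : ℕ) (z : ℝ) => z ^ (k + 1) / Real.Gamma (1 + β * (k + 1 : ℕ)))
      (g' := fun (k : ℕ) (z : ℝ) => z ^ k / Real.Gamma (β + β * k) / β) (t := Metric.ball (0 : ℝ) (|s| + 1)) (y₀ := (0 : ℝ))
      ((ml_geom C).div_const β) Metric.isOpen_ball (convex_ball _ _).isPreconnected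
      ?_ ?_ (Metric.mem_ball_self (by positivity)) ?_
      (mem_ball_zero_iff.2 (by rw [Real.norm_eq_abs]; linarith))
    · intro k y _
      have := (hasDerivAt_pow (k + 1) y).div_const (Real.Gamma (1 + β * (k + 1 : ℕ)))
      refine this.congr_deriv ?_
      have hp : 0 < β + β * k := by positivity
      have hG := Real.Gamma_pos_of_pos hp
      push_cast
      rw [show 1 + β * ((k : ℝ) + 1) = (β + β * k) + 1 by ring, Real.Gamma_add_one hp.ne']
      rw [div_div, div_eq_div_iff (by positivity) (by positivity)]
      ring
    · intro k y hy
      rw [norm_div, Real.norm_of_nonneg hβ.le]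
      have := h k y (by simpa using (mem_ball_zero_iff.1 hy).le)
      gcongr
    · simp [summable_zero]
  have e : mittagLeffler β = fun z => 1 + ∑' k : ℕ, z ^ (k + 1) / Real.Gamma (1 + β * (k + 1 : ℕ)) := by
    funext z
    rw [ml_eq, mlTwo, (mlTwo_summable hβ one_pos z).tsum_eq_zero_add]
    simp
  rw [e]
  have := key.const_add 1
  rwa [tsum_div_const] at this

theorem beta_integrable {a c t : ℝ} (ha : 0 < a) (hc : 0 < c) (ht : 0 < t) :
    IntegrableOn (fun s : ℝ => s ^ (a - 1) * (t - s) ^ (c - 1)) (Set.Ioo 0 t) := by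
  rw [← intervalIntegrable_iff_integrableOn_Ioo_of_le ht.le]
  refine IntervalIntegrable.trans (b := t / 2) ?_ ?_
  · apply IntervalIntegrable.mul_continuousOn
    · exact intervalIntegral.intervalIntegrable_rpow' (by linarith)
    · intro x hx
      rw [Set.uIcc_of_le (by positivity)] at hx
      exact ((continuousAt_const.sub continuousAt_id).rpow_const
        (Or.inl (by have := hx.2; intro h; change t - x = 0 at h; linarith))).continuousWithinAt
  · apply IntervalIntegrable.continuousOn_mul
    · have h := (intervalIntegral.intervalIntegrable_rpow' (a := t / 2) (b := 0) (r := c - 1)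
        (by linarith)).comp_sub_left t
      convert h using 1 <;> ring
    · intro x hx
      rw [Set.uIcc_of_le (by linarith)] at hx
      exact (continuousAt_id.rpow_const
        (Or.inl (by have := hx.1; intro h; change x = 0 at h; linarith))).continuousWithinAt

theorem beta_integral {a c t : ℝ} (ha : 0 < a) (hc : 0 < c) (ht : 0 < t) :
    ∫ s in Set.Ioo 0 t, s ^ (a - 1) * (t - s) ^ (c - 1)
      = t ^ (a + c - 1) * (Real.Gamma a * Real.Gamma c / Real.Gamma (a + c)) := by
  have h := Complex.betaIntegral_scaled a c ht
  rw [Complex.betaIntegral_eq_Gamma_mul_div _ _ (by simpa) (by simpa),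
    intervalIntegral.integral_of_le ht.le, integral_Ioc_eq_integral_Ioo] at h
  have h2 : ∫ x in Set.Ioo 0 t, (x : ℂ) ^ ((a : ℂ) - 1) * ((t : ℂ) - x) ^ ((c : ℂ) - 1)
      = ((∫ s in Set.Ioo 0 t, s ^ (a - 1) * (t - s) ^ (c - 1) : ℝ) : ℂ) := by
    rw [← integral_complex_ofReal]
    refine setIntegral_congr_fun measurableSet_Ioo fun x hx => ?_
    rw [Complex.ofReal_mul, Complex.ofReal_cpow hx.1.le, Complex.ofReal_cpow (by linarith [hx.2])]
    push_cast; rfl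
  rw [h2] at h
  apply Complex.ofReal_injective
  rw [h, Complex.ofReal_mul, Complex.ofReal_cpow ht.le]
  push_cast
  rw [Complex.Gamma_ofReal, Complex.Gamma_ofReal, ← Complex.ofReal_add, Complex.Gamma_ofReal]

theorem mlTwo_integrable {β b c t x : ℝ} (hβ : 0 < β) (hb : 0 < b) (hc : 0 < c) (ht : 0 < t) :
    IntegrableOn (fun s : ℝ => s ^ (b - 1) * mlTwo β b (-(x * s ^ β)) * (t - s) ^ (c - 1))
      (Set.Ioo 0 t) := by
  have hcont : Continuous fun s : ℝ => mlTwo β b (-(x * s ^ β)) := by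
    have := mlTwo_continuous hβ hb
    have h2 : Continuous fun s : ℝ => s ^ β := Real.continuous_rpow_const hβ.le
    fun_prop
  obtain ⟨C, hC⟩ := isCompact_Icc.exists_bound_of_continuousOn (s := Set.Icc 0 t) hcont.continuousOn
  have h1 := beta_integrable hb hc ht
  have := h1.bdd_mul (c := C) (f := fun s : ℝ => mlTwo β b (-(x * s ^ β)))
    hcont.aestronglyMeasurable
    ((ae_restrict_iff' measurableSet_Ioo).2 (Eventually.of_forall fun s hs => hC s ⟨hs.1.le, hs.2.le⟩))
  refine this.congr (Eventually.of_forall fun s => ?_)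
  simp only; ring

theorem mlTwo_integral {β b c t x : ℝ} (hβ : 0 < β) (hb : 0 < b) (hc : 0 < c) (ht : 0 < t)  :
    ∫ s in Set.Ioo 0 t, s ^ (b - 1) * mlTwo β b (-(x * s ^ β)) * (t - s) ^ (c - 1)
      = Real.Gamma c * t ^ (b + c - 1) * mlTwo β (b + c) (-(x * t ^ β)) := by
  let F : ℕ → ℝ → ℝ := fun k s =>
    ((-x) ^ k / Real.Gamma (b + β * k)) * (s ^ (b + β * k - 1) * (t - s) ^ (c - 1))
  have hbk : ∀ k : ℕ, 0 < b + β * k := fun k => by positivity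
  have hFi : ∀ k, Integrable (F k) (volume.restrict (Set.Ioo 0 t)) := fun k =>
    (beta_integrable (hbk k) hc ht).const_mul _
  have hval : ∀ k : ℕ, ∀ r : ℝ, (r ^ k / Real.Gamma (b + β * k)) *
      (t ^ (b + β * k + c - 1) * (Real.Gamma (b + β * k) * Real.Gamma c / Real.Gamma (b + β * k + c)))
      = Real.Gamma c * t ^ (b + c - 1) * ((r * t ^ β) ^ k / Real.Gamma (b + c + β * k)) := by
    intro k r
    have := Real.Gamma_pos_of_pos (hbk k)
    rw [show b + β * k + c - 1 = (b + c - 1) + β * k by ring, Real.rpow_add ht,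
      Real.rpow_mul ht.le, Real.rpow_natCast, show b + β * k + c = b + c + β * k by ring, mul_pow]
    field_simp
  have hnorm : ∀ k, ∫ s in Set.Ioo 0 t, ‖F k s‖ =
      Real.Gamma c * t ^ (b + c - 1) * ((|x| * t ^ β) ^ k / Real.Gamma (b + c + β * k)) := by
    intro k
    rw [← hval, ← beta_integral (hbk k) hc ht, ← integral_const_mul]
    refine setIntegral_congr_fun measurableSet_Ioo fun s hs => ?_
    have h1 : 0 < s := hs.1
    have h2 : 0 < t - s := by linarith [hs.2]
    have := Real.Gamma_pos_of_pos (hbk k)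
    simp only [F]
    rw [norm_mul, norm_div, norm_pow, norm_neg, Real.norm_eq_abs, Real.norm_of_nonneg this.le,
      Real.norm_of_nonneg (by positivity)]
  have hs := hasSum_integral_of_summable_integral_norm hFi (by
    simp_rw [hnorm]
    exact (mlTwo_summable hβ (by positivity) _).mul_left _)
  have e1 : ∫ s in Set.Ioo 0 t, s ^ (b - 1) * mlTwo β b (-(x * s ^ β)) * (t - s) ^ (c - 1)
      = ∫ s in Set.Ioo 0 t, ∑' k, F k s := by
    refine setIntegral_congr_fun measurableSet_Ioo fun s hs => ?_
    have h1 : 0 < s := hs.1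
    simp only [F, mlTwo]
    rw [← tsum_mul_left, ← tsum_mul_right]
    refine tsum_congr fun k => ?_
    rw [show b + β * k - 1 = (b - 1) + β * k by ring, Real.rpow_add h1,
      Real.rpow_mul h1.le, Real.rpow_natCast, ← neg_mul, mul_pow]
    ring
  rw [e1, ← hs.tsum_eq, mlTwo, ← tsum_mul_left]
  refine tsum_congr fun k => ?_
  rw [← neg_mul, ← hval, ← beta_integral (hbk k) hc ht, ← integral_const_mul]

theorem frac_min_principle {β : ℝ} (hβ : 0 < β) (hβ1 : β < 1) {w w' : ℝ → ℝ} (hc : Continuous w)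
    (hd : ∀ s, 0 < s → HasDerivAt w (w' s) s)
    (hi : ∀ t, 0 < t → IntegrableOn (fun s => w' s * (t - s) ^ (1 - β - 1)) (Set.Ioo 0 t))
    (h0 : 0 ≤ w 0)
    (hD : ∀ t, 0 < t → w t < 0 → 0 ≤ ∫ s in Set.Ioo 0 t, w' s * (t - s) ^ (1 - β - 1)) :
    ∀ t, 0 ≤ t → 0 ≤ w t := by
  intro T hT
  by_contra! hneg
  obtain ⟨t₀, ht₀, hmin⟩ := isCompact_Icc.exists_isMinOn (s := Set.Icc 0 T) ⟨T, hT, le_rfl⟩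
    hc.continuousOn
  have hwt : w t₀ < 0 := lt_of_le_of_lt (hmin ⟨hT, le_rfl⟩) hneg
  have htpos : 0 < t₀ := by
    rcases ht₀.1.lt_or_eq with h | h
    · exact h
    · rw [← h] at hwt; linarith
  have hv : ∀ s ∈ Set.Icc 0 t₀, 0 ≤ w s - w t₀ := fun s hs =>
    sub_nonneg.2 (hmin ⟨hs.1, hs.2.trans ht₀.2⟩)
  let h : ℝ → ℝ := fun s => (t₀ - s) ^ (-β) * (w s - w t₀)
  have hcont : ContinuousOn h (Set.Icc 0 t₀) := by
    intro s hs
    rcases hs.2.lt_or_eq with hlt | heq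
    · have : t₀ - s ≠ 0 := by intro hh; linarith
      exact (((continuousAt_const.sub continuousAt_id).rpow_const (Or.inl this)).mul
        (hc.continuousAt.sub continuousAt_const)).continuousWithinAt
    · subst heq
      have hO := (hd s htpos).differentiableAt.isBigO_sub
      obtain ⟨C, hC⟩ := hO.bound
      have hz : h s = 0 := by simp [h]
      rw [ContinuousWithinAt, hz]
      have hlim : Tendsto (fun y : ℝ => C * (s - y) ^ (1 - β)) (𝓝[Set.Icc 0 s] s) (𝓝 0) := by
        have : Continuous fun y : ℝ => C * (s - y) ^ (1 - β) :=
          continuous_const.mul ((continuous_const.sub continuous_id).rpow_const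
            (fun _ => Or.inr (by linarith)))
        have h3 := (this.tendsto s).mono_left (nhdsWithin_le_nhds (s := Set.Icc 0 s))
        simpa [Real.zero_rpow (show 1 - β ≠ 0 by intro hh; linarith)] using h3
      refine squeeze_zero_norm' ?_ hlim
      filter_upwards [nhdsWithin_le_nhds hC, self_mem_nhdsWithin] with y hy hys
      rcases hys.2.lt_or_eq with hlt | heq
      · have hp : 0 < s - y := by linarith
        simp only [h]
        rw [norm_mul, Real.norm_of_nonneg (by positivity)]
        rw [Real.norm_eq_abs (y - s), abs_sub_comm, abs_of_pos hp] at hy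
        calc (s - y) ^ (-β) * ‖w y - w s‖ ≤ (s - y) ^ (-β) * (C * (s - y)) := by gcongr
          _ = C * (s - y) ^ (1 - β) := by
            rw [show 1 - β = -β + 1 by ring, Real.rpow_add hp, Real.rpow_one]; ring
      · subst heq
        rw [hz]
        simp [Real.zero_rpow (show 1 - β ≠ 0 by intro hh; linarith)]
  have hint := hi t₀ htpos
  have key := intervalIntegral.integral_le_sub_of_hasDeriv_right_of_le (g := h)
    (g' := fun s => -1 * (-β) * (t₀ - s) ^ (-β - 1) * (w s - w t₀) + (t₀ - s) ^ (-β) * w' s)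
    (φ := fun s => w' s * (t₀ - s) ^ (1 - β - 1)) htpos.le hcont ?_ ?_ ?_
  · rw [intervalIntegral.integral_of_le htpos.le, integral_Ioc_eq_integral_Ioo] at key
    have h1 := hD t₀ htpos hwt
    have h2 : h t₀ = 0 := by simp [h]
    have h3 : 0 < h 0 := by
      simp only [h, sub_zero]
      have : 0 < w 0 - w t₀ := by linarith
      positivity
    linarith
  · intro s hs
    have hp : t₀ - s ≠ 0 := by intro hh; linarith [hs.2]
    have e1 : HasDerivAt (fun s : ℝ => t₀ - s) (-1) s := by
      simpa using (hasDerivAt_id s).const_sub t₀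
    exact ((e1.rpow_const (p := -β) (Or.inl hp)).mul
      ((hd s hs.1).sub_const (w t₀))).hasDerivWithinAt
  · exact (integrableOn_Icc_iff_integrableOn_Ioo).2 hint
  · intro s hs
    have hp : 0 < t₀ - s := by linarith [hs.2]
    have := hv s ⟨hs.1.le, hs.2.le⟩
    have h5 : 0 ≤ -1 * (-β) * (t₀ - s) ^ (-β - 1) * (w s - w t₀) := by
      rw [show -1 * (-β) = β by ring]; positivity
    rw [show 1 - β - 1 = -β by ring]
    linarith

theorem ml_continuous {β : ℝ} (hβ : 0 < β) : Continuous (mittagLeffler β) :=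
  mlTwo_continuous hβ one_pos

theorem ml_comp_continuous {β : ℝ} (hβ : 0 < β) (x : ℝ) :
    Continuous fun s : ℝ => mittagLeffler β (-(x * s ^ β)) := by
  have := ml_continuous hβ
  have h2 : Continuous fun s : ℝ => s ^ β := Real.continuous_rpow_const hβ.le
  fun_prop

theorem ml_comp_deriv {β : ℝ} (hβ : 0 < β) (x : ℝ) (s : ℝ) (hs : 0 < s) :
    HasDerivAt (fun s : ℝ => mittagLeffler β (-(x * s ^ β)))
      (-x * (s ^ (β - 1) * mlTwo β β (-(x * s ^ β)))) s := by
  have h1 : HasDerivAt (fun s : ℝ => -(x * s ^ β)) (-(x * (β * s ^ (β - 1)))) s :=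
    ((Real.hasDerivAt_rpow_const (Or.inl hs.ne')).const_mul x).neg
  have := (ml_hasDerivAt hβ (-(x * s ^ β))).comp s h1
  refine this.congr_deriv ?_
  field_simp

theorem ml_comp_int {β : ℝ} (hβ : 0 < β) (hβ1 : β < 1) (x : ℝ) (t : ℝ) (ht : 0 < t) :
    IntegrableOn (fun s : ℝ => (-x * (s ^ (β - 1) * mlTwo β β (-(x * s ^ β)))) *
      (t - s) ^ (1 - β - 1)) (Set.Ioo 0 t) := by
  have := (mlTwo_integrable (x := x) hβ hβ (sub_pos.2 hβ1) ht).const_mul (-x)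
  refine this.congr (Eventually.of_forall fun s => ?_)
  ring

theorem ml_comp_caputo {β : ℝ} (hβ : 0 < β) (hβ1 : β < 1) (x : ℝ) (t : ℝ) (ht : 0 < t) :
    ∫ s in Set.Ioo 0 t, (-x * (s ^ (β - 1) * mlTwo β β (-(x * s ^ β)))) *
      (t - s) ^ (1 - β - 1) = -x * Real.Gamma (1 - β) * mittagLeffler β (-(x * t ^ β)) := by
  have := mlTwo_integral (x := x) hβ hβ (sub_pos.2 hβ1) ht
  rw [show β + (1 - β) = 1 by ring, sub_self, Real.rpow_zero, mul_one, ← ml_eq] at this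
  rw [mul_assoc, ← this, ← integral_const_mul]
  refine integral_congr_ae (Eventually.of_forall fun s => ?_)
  ring

theorem ml_zero (β : ℝ) (hβ : 0 < β) : mittagLeffler β 0 = 1 := by
  rw [ml_shift hβ]; simp

theorem ml_comp_nonneg {β : ℝ} (hβ : 0 < β) (hβ1 : β < 1) {x : ℝ} (hx : 0 ≤ x) :
    ∀ t, 0 ≤ t → 0 ≤ mittagLeffler β (-(x * t ^ β)) := by
  have hG := Real.Gamma_pos_of_pos (sub_pos.2 hβ1)
  refine frac_min_principle hβ hβ1 (ml_comp_continuous hβ x) (ml_comp_deriv hβ x)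
    (ml_comp_int hβ hβ1 x) ?_ ?_
  · simp [Real.zero_rpow hβ.ne', ml_zero β hβ]
  · intro t ht hneg
    rw [ml_comp_caputo hβ hβ1 x t ht]
    have := mul_nonneg (mul_nonneg hx hG.le) (neg_nonneg.2 hneg.le)
    linarith

theorem ml_nonneg {β : ℝ} (hβ : 0 < β) (hβ1 : β < 1) {x : ℝ} (hx : 0 ≤ x) :
    0 ≤ mittagLeffler β (-x) := by
  simpa using ml_comp_nonneg hβ hβ1 hx 1 zero_le_one

theorem ml_anti {β : ℝ} (hβ : 0 < β) (hβ1 : β < 1) {x y : ℝ} (hx : 0 ≤ x) (hxy : x ≤ y) :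
    mittagLeffler β (-y) ≤ mittagLeffler β (-x) := by
  have hG := Real.Gamma_pos_of_pos (sub_pos.2 hβ1)
  have hy := hx.trans hxy
  have key := frac_min_principle hβ hβ1
    ((ml_comp_continuous hβ x).sub (ml_comp_continuous hβ y))
    (fun s hs => (ml_comp_deriv hβ x s hs).sub (ml_comp_deriv hβ y s hs))
    (fun t ht => by
      simp only [sub_mul]
      exact (ml_comp_int hβ hβ1 x t ht).sub (ml_comp_int hβ hβ1 y t ht))
    (by simp [Real.zero_rpow hβ.ne'])
    (fun t ht hneg => by
      simp only [sub_mul]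
      rw [integral_sub (ml_comp_int hβ hβ1 x t ht) (ml_comp_int hβ hβ1 y t ht),
        ml_comp_caputo hβ hβ1 x t ht, ml_comp_caputo hβ hβ1 y t ht]
      have h1 := ml_comp_nonneg hβ hβ1 hy t ht.le
      simp only [Pi.sub_apply] at hneg
      have h2 : 0 ≤ Real.Gamma (1 - β) * (x * (mittagLeffler β (-(y * t ^ β)) -
        mittagLeffler β (-(x * t ^ β))) + (y - x) * mittagLeffler β (-(y * t ^ β))) := by
        have : 0 ≤ y - x := by linarith
        have : 0 ≤ mittagLeffler β (-(y * t ^ β)) - mittagLeffler β (-(x * t ^ β)) := by linarith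
        positivity
      linarith)
    1 zero_le_one
  simpa using key

theorem ml_le_one {β : ℝ} (hβ : 0 < β) (hβ1 : β < 1) {x : ℝ} (hx : 0 ≤ x) :
    mittagLeffler β (-x) ≤ 1 := by
  simpa [ml_zero β hβ] using ml_anti hβ hβ1 le_rfl hx

theorem ml_decay {β : ℝ} (hβ : 0 < β) (hβ1 : β < 1) {x : ℝ} (hx : 0 ≤ x) :
    mittagLeffler β (-x) * x ≤ Real.Gamma (1 + β) := by
  have hG := Real.Gamma_pos_of_pos hβ
  have h1 := mlTwo_integral (x := x) hβ one_pos hβ one_pos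
  have h2 := mlTwo_integrable (x := x) hβ one_pos hβ one_pos
  simp only [sub_self, Real.rpow_zero, one_mul, Real.one_rpow, mul_one, ← ml_eq] at h1 h2
  have h3 := beta_integral one_pos hβ one_pos
  have h4 := beta_integrable one_pos hβ one_pos
  simp only [sub_self, Real.rpow_zero, one_mul, Real.one_rpow, Real.Gamma_one] at h3 h4
  have h5 : ∫ s in Set.Ioo (0 : ℝ) 1, mittagLeffler β (-x) * (1 - s) ^ (β - 1) ≤
      ∫ s in Set.Ioo (0 : ℝ) 1, mittagLeffler β (-(x * s ^ β)) * (1 - s) ^ (β - 1) := by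
    refine setIntegral_mono_on (h4.const_mul _) h2 measurableSet_Ioo fun s hs => ?_
    have : 0 < 1 - s := by linarith [hs.2]
    have hs0 : 0 < s := hs.1
    refine mul_le_mul_of_nonneg_right (ml_anti hβ hβ1 (by positivity) ?_) (by positivity)
    exact mul_le_of_le_one_right hx (Real.rpow_le_one hs0.le hs.2.le hβ.le)
  rw [integral_const_mul, h1, h3, add_comm 1 β, Real.Gamma_add_one hβ.ne'] at h5
  have h6 : mittagLeffler β (-x) ≤ Gamma β * β * mlTwo β (β + 1) (-x) := by
    rw [add_comm β 1, add_comm 1 β] at h5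
    field_simp at h5
    linarith
  have h7 := ml_shift hβ (-x)
  have h8 := ml_nonneg hβ hβ1 hx
  rw [add_comm 1 β] at h7 ⊢
  rw [Real.Gamma_add_one hβ.ne']
  have h9 := mul_le_mul_of_nonneg_right h6 hx
  have h10 : 0 ≤ Gamma β * β * mittagLeffler β (-x) := by positivity
  have h11 : Gamma β * β * mlTwo β (β + 1) (-x) * x
      = Gamma β * β - Gamma β * β * mittagLeffler β (-x) := by rw [h7]; ring
  linarith

theorem ml_sq_integrable {β α c : ℝ} (hβ : 0 < β) (hβ1 : β < 1) (hα : 1 / 2 < α) (hc : 0 < c) :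
    Integrable fun l : ℝ => (mittagLeffler β (-(c * |l| ^ α))) ^ 2 := by
  have hG : 0 < Real.Gamma (1 + β) := Real.Gamma_pos_of_pos (by positivity)
  have hα0 : 0 < α := by linarith
  set K : ℝ := 2 ^ α * (1 + Real.Gamma (1 + β) / c) with hK
  have hK0 : 0 < K := by positivity
  have hi : Integrable fun l : ℝ => K ^ 2 * (1 + ‖l‖) ^ (-(2 * α)) :=
    (integrable_one_add_norm (by simp; linarith)).const_mul _
  refine hi.mono' ?_ (Eventually.of_forall fun l => ?_)
  · have h1 := ml_continuous hβ
    have h2 : Continuous fun l : ℝ => |l| ^ α := continuous_abs.rpow_const fun _ => Or.inr hα0.le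
    exact Continuous.aestronglyMeasurable (by fun_prop)
  · have hx : 0 ≤ c * |l| ^ α := by positivity
    have e0 := ml_nonneg hβ hβ1 hx
    have e1 := ml_le_one hβ hβ1 hx
    have e2 := ml_decay hβ hβ1 hx
    set E := mittagLeffler β (-(c * |l| ^ α)) with hE
    have hp : (1 + |l|) ^ α ≤ 2 ^ α * (1 + |l| ^ α) := by
      have hq : 0 ≤ |l| ^ α := by positivity
      rcases le_total |l| 1 with h | h
      · calc (1 + |l|) ^ α ≤ 2 ^ α := Real.rpow_le_rpow (by positivity) (by linarith) hα0.le
          _ ≤ _ := le_mul_of_one_le_right (by positivity) (by linarith)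
      · calc (1 + |l|) ^ α ≤ (2 * |l|) ^ α :=
              Real.rpow_le_rpow (by positivity) (by linarith) hα0.le
          _ = 2 ^ α * |l| ^ α := Real.mul_rpow (by norm_num) (by positivity)
          _ ≤ _ := by gcongr; linarith
    have h3 : E * |l| ^ α ≤ Real.Gamma (1 + β) / c := by
      rw [le_div_iff₀ hc]; linarith
    have h4 : E * (1 + |l|) ^ α ≤ K := by
      calc E * (1 + |l|) ^ α ≤ E * (2 ^ α * (1 + |l| ^ α)) := by gcongr
        _ = 2 ^ α * (E + E * |l| ^ α) := by ring
        _ ≤ K := by rw [hK]; gcongr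
    have hpos : 0 < 1 + |l| := by positivity
    rw [Real.norm_of_nonneg (by positivity), Real.norm_eq_abs, Real.rpow_neg hpos.le,
      ← div_eq_mul_inv, le_div_iff₀ (by positivity), mul_comm 2 α, Real.rpow_mul hpos.le,
      Real.rpow_two, ← mul_pow]
    exact pow_le_pow_left₀ (by positivity) h4 2

theorem besselK_continuousAt {ν z : ℝ} (hν : -1 < ν) (hz : 0 < z) :
    ContinuousAt (besselK ν) z := by
  unfold besselK
  refine continuousAt_const.mul ?_
  have hb := (integrableOn_rpow_mul_exp_neg_mul_rpow (p := 1) hν one_pos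
    (show 0 < z / 4 by positivity)).const_mul (4 / z)
  refine continuousAt_of_dominated ?_ ?_ hb ?_
  · refine Eventually.of_forall fun x => ?_
    refine ContinuousOn.aestronglyMeasurable ?_ measurableSet_Ioi
    intro s hs
    have hs0 : s ≠ 0 := (Set.mem_Ioi.1 hs).ne'
    refine ContinuousAt.continuousWithinAt ?_
    exact (continuousAt_id.rpow_const (Or.inl hs0)).mul
      (Real.continuous_exp.continuousAt.comp (continuousAt_const.mul
        (continuousAt_id.add (continuousAt_const.div continuousAt_id hs0))))
  · filter_upwards [lt_mem_nhds (show z / 2 < z by linarith)] with x hx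
    refine (ae_restrict_iff' measurableSet_Ioi).2 (Eventually.of_forall fun s hs => ?_)
    have hs0 : 0 < s := hs
    rw [Real.norm_of_nonneg (by positivity)]
    have h1 : Real.exp (-(x / 2) * (s + 1 / s)) ≤ Real.exp (-(z / 4) * s) * (4 / z * s) := by
      have e : Real.exp (-(z / 4) * (1 / s)) ≤ 4 / z * s := by
        have h2 : z / 4 * (1 / s) ≤ Real.exp (z / 4 * (1 / s)) := by
          linarith [Real.add_one_le_exp (z / 4 * (1 / s))]
        rw [neg_mul, Real.exp_neg]
        calc (Real.exp (z / 4 * (1 / s)))⁻¹ ≤ (z / 4 * (1 / s))⁻¹ :=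
              inv_anti₀ (by positivity) h2
          _ = 4 / z * s := by field_simp
      calc Real.exp (-(x / 2) * (s + 1 / s)) ≤ Real.exp (-(z / 4) * (s + 1 / s)) := by
            apply Real.exp_le_exp.2
            have : 0 < s + 1 / s := by positivity
            nlinarith
        _ = Real.exp (-(z / 4) * s) * Real.exp (-(z / 4) * (1 / s)) := by
            rw [← Real.exp_add]; congr 1; ring
        _ ≤ _ := by gcongr
    calc s ^ (ν - 1) * Real.exp (-(x / 2) * (s + 1 / s))
        ≤ s ^ (ν - 1) * (Real.exp (-(z / 4) * s) * (4 / z * s)) := by gcongr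
      _ = 4 / z * (s ^ ν * Real.exp (-(z / 4) * s ^ (1 : ℝ))) := by
        rw [Real.rpow_sub_one hs0.ne', Real.rpow_one]; field_simp
  · refine Eventually.of_forall fun s => ?_
    fun_prop

theorem specDensity_continuousAt {n : ℕ} {w κ A : ℕ → ℝ}
    (hκ : ∀ j ∈ Finset.range (n + 1), κ j ∈ Set.Ioo (0 : ℝ) 1) (hA0 : A 0 = 0) {y : ℝ}
    (hy : ∀ j ∈ Finset.Icc 1 n, |y| < w j) : ContinuousAt (specDensity n w κ A) y := by
  have e : specDensity n w κ A = fun lam => ∑ j ∈ Finset.Icc 1 n,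
      (2 : ℝ) ^ ((1 - κ j) / 2) / (Real.sqrt Real.pi * Real.Gamma (κ j / 2)) / 2 * A j *
        (besselK ((κ j - 1) / 2) |lam + w j| * |lam + w j| ^ ((κ j - 1) / 2) +
          besselK ((κ j - 1) / 2) |lam - w j| * |lam - w j| ^ ((κ j - 1) / 2)) := by
    funext lam; simp [specDensity, hA0]
  rw [e]
  refine tendsto_finsetSum _ fun j hj => ?_
  have hyj := abs_lt.1 (hy j hj)
  have hj' := Finset.mem_Icc.1 hj
  have hκj := hκ j (Finset.mem_range.2 (by omega))
  have hν : -1 < (κ j - 1) / 2 := by linarith [hκj.1]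
  have h1 : 0 < |y + w j| := abs_pos.2 (by intro h; linarith)
  have h2 : 0 < |y - w j| := abs_pos.2 (by intro h; linarith)
  have c1 : ContinuousAt (fun l : ℝ => |l + w j|) y := by fun_prop
  have c2 : ContinuousAt (fun l : ℝ => |l - w j|) y := by fun_prop
  exact continuousAt_const.mul
    (((ContinuousAt.comp (f := fun l : ℝ => |l + w j|) (besselK_continuousAt hν h1) c1).mul
        (c1.rpow_const (Or.inl h1.ne'))).add
      ((ContinuousAt.comp (f := fun l : ℝ => |l - w j|) (besselK_continuousAt hν h2) c2).mul
        (c2.rpow_const (Or.inl h2.ne'))))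

theorem specDensity_zero {n : ℕ} {w κ A : ℕ → ℝ} (hw : ∀ j ∈ Finset.Icc 1 n, 0 < w j)
    (hA0 : A 0 = 0) : specDensity n w κ A 0 = specDensityZero n w κ A := by
  simp only [specDensity, specDensityZero, hA0, mul_zero, zero_mul, zero_add, zero_sub, abs_neg]
  refine Finset.sum_congr rfl fun j hj => ?_
  rw [abs_of_pos (hw j hj)]
  ring

theorem rpow_tendsto_zero {p : ℝ} (hp : 0 < p) :
    Tendsto (fun ε : ℝ => ε ^ p) (𝓝[>] (0 : ℝ)) (𝓝 0) := by
  have h := (Real.continuousAt_rpow_const 0 p (Or.inr hp.le)).tendsto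
  rw [Real.zero_rpow hp.ne'] at h
  exact h.mono_left nhdsWithin_le_nhds

/-- With `A₀ = 0`, `α > 1/2`, and `δ ∈ (β/(2α²), β/α)`, the integral over `|λ| ≤ ε^{−δ}` of
`E_β²(−μ|λ|^α(1+λ²ε^{2β/α})^{γ/2} t^β) f(ε^{β/α}λ)` converges to
`f(0) ∫_ℝ E_β²(−μ|λ|^α t^β) dλ` as `ε → 0⁺`. -/
theorem inner_region_limit (n : ℕ) (hn : 1 ≤ n) (w κ A : ℕ → ℝ)
    (hw0 : w 0 = 0) (hw : ∀ j ∈ Finset.Icc 1 n, 0 < w j)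
    (hκ : ∀ j ∈ Finset.range (n + 1), κ j ∈ Set.Ioo (0 : ℝ) 1)
    (hA : ∀ j ∈ Finset.range (n + 1), 0 ≤ A j)
    (hAsum : ∑ j ∈ Finset.range (n + 1), A j = 1) (hA0 : A 0 = 0)
    (β α γ μ t δ : ℝ) (hβ : β ∈ Set.Ioo (0 : ℝ) 1) (hα : 1 / 2 < α) (hγ : 0 < γ)
    (hμ : 0 < μ) (ht : 0 < t) (hδ : δ ∈ Set.Ioo (β / (2 * α ^ 2)) (β / α)) :
    Filter.Tendsto
      (fun ε : ℝ =>
        ∫ lam in {l : ℝ | |l| ≤ ε ^ (-δ)},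
          (mittagLeffler β
              (-(μ * |lam| ^ α * (1 + lam ^ 2 * ε ^ (2 * β / α)) ^ (γ / 2) * t ^ β))) ^ 2 *
            specDensity n w κ A (ε ^ (β / α) * lam))
      (𝓝[>] (0 : ℝ))
      (𝓝 (specDensityZero n w κ A *
        ∫ lam : ℝ, (mittagLeffler β (-(μ * |lam| ^ α * t ^ β))) ^ 2)) := by
  obtain ⟨hβ0, hβ1⟩ := hβ
  have hα0 : 0 < α := by linarith
  have hδ0 : 0 < δ := lt_trans (by positivity) hδ.1
  have hc : 0 < μ * t ^ β := by positivity
  have hmlc := ml_continuous hβ0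
  -- a neighbourhood of the origin on which the density is continuous
  have hev : ∀ᶠ y in 𝓝 (0 : ℝ), ∀ j ∈ Finset.Icc 1 n, |y| < w j := by
    rw [Filter.eventually_all_finset]
    intro j hj
    have : Tendsto (fun y : ℝ => |y|) (𝓝 0) (𝓝 0) := by
      simpa using (continuous_abs (G := ℝ)).tendsto 0
    exact this.eventually (gt_mem_nhds (hw j hj))
  obtain ⟨r, hr, hball⟩ := Metric.nhds_basis_closedBall.eventually_iff.1 hev
  have hfc : ContinuousOn (specDensity n w κ A) (Metric.closedBall 0 r) := fun y hy =>
    (specDensity_continuousAt hκ hA0 (hball hy)).continuousWithinAt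
  obtain ⟨M, hM⟩ := (isCompact_closedBall (0 : ℝ) r).exists_bound_of_continuousOn hfc
  have hinside : ∀ᶠ ε in 𝓝[>] (0 : ℝ), 0 < ε ∧
      ∀ l : ℝ, |l| ≤ ε ^ (-δ) → ε ^ (β / α) * l ∈ Metric.closedBall (0 : ℝ) r := by
    have h1 := (rpow_tendsto_zero (sub_pos.2 hδ.2)).eventually (gt_mem_nhds hr)
    filter_upwards [h1, self_mem_nhdsWithin] with ε hε hpos
    have hpos : 0 < ε := hpos
    refine ⟨hpos, fun l hl => mem_closedBall_zero_iff.2 ?_⟩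
    rw [Real.norm_eq_abs, abs_mul, abs_of_pos (by positivity : 0 < ε ^ (β / α))]
    calc ε ^ (β / α) * |l| ≤ ε ^ (β / α) * ε ^ (-δ) := by gcongr
      _ = ε ^ (β / α - δ) := by rw [← Real.rpow_add hpos, sub_eq_add_neg]
      _ ≤ r := hε.le
  have hSm : ∀ ε : ℝ, MeasurableSet {l : ℝ | |l| ≤ ε ^ (-δ)} := fun ε =>
    measurableSet_le continuous_abs.measurable measurable_const
  have habs : Continuous fun l : ℝ => |l| ^ α := continuous_abs.rpow_const fun _ => Or.inr hα0.le
  rw [← integral_const_mul]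
  simp_rw [fun ε => (integral_indicator (hSm ε)
    (f := fun lam => (mittagLeffler β
              (-(μ * |lam| ^ α * (1 + lam ^ 2 * ε ^ (2 * β / α)) ^ (γ / 2) * t ^ β))) ^ 2 *
            specDensity n w κ A (ε ^ (β / α) * lam)) (μ := volume)).symm]
  refine tendsto_integral_filter_of_dominated_convergence
    (fun l => (mittagLeffler β (-((μ * t ^ β) * |l| ^ α))) ^ 2 * M) ?_ ?_
    ((ml_sq_integrable hβ0 hβ1 hα hc).mul_const M) ?_
  · filter_upwards [hinside] with ε hε
    obtain ⟨hpos, hε⟩ := hε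
    rw [aestronglyMeasurable_indicator_iff (hSm ε)]
    refine ContinuousOn.aestronglyMeasurable ?_ (hSm ε)
    have hpw : Continuous fun l : ℝ => (1 + l ^ 2 * ε ^ (2 * β / α)) ^ (γ / 2) := by
      refine Continuous.rpow_const (by fun_prop) fun _ => Or.inr (by positivity)
    refine ContinuousOn.mul (Continuous.continuousOn (by fun_prop)) ?_
    exact hfc.comp (by fun_prop) (fun l hl => hε l hl)
  · filter_upwards [hinside] with ε hε
    obtain ⟨hpos, hε⟩ := hε
    refine Eventually.of_forall fun l => ?_
    have hM0 : 0 ≤ M := (norm_nonneg _).trans (hM 0 (Metric.mem_closedBall_self hr.le))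
    by_cases hl : l ∈ {l : ℝ | |l| ≤ ε ^ (-δ)}
    · rw [Set.indicator_of_mem hl, norm_mul, norm_pow]
      have hone : 1 ≤ (1 + l ^ 2 * ε ^ (2 * β / α)) ^ (γ / 2) :=
        Real.one_le_rpow (le_add_of_nonneg_right (by positivity)) (by positivity)
      have hle : μ * t ^ β * |l| ^ α ≤
          μ * |l| ^ α * (1 + l ^ 2 * ε ^ (2 * β / α)) ^ (γ / 2) * t ^ β := by
        have := le_mul_of_one_le_right (show 0 ≤ μ * t ^ β * |l| ^ α by positivity) hone
        linarith
      have hx : 0 ≤ μ * t ^ β * |l| ^ α := by positivity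
      have h1 := ml_anti hβ0 hβ1 hx hle
      have h2 := ml_nonneg hβ0 hβ1 (hx.trans hle)
      rw [Real.norm_of_nonneg h2]
      exact mul_le_mul (pow_le_pow_left₀ h2 h1 2) (hM _ (hε l hl)) (norm_nonneg _) (by positivity)
    · rw [Set.indicator_of_notMem hl, norm_zero]
      positivity
  · refine Eventually.of_forall fun l => ?_
    have hmem : ∀ᶠ ε in 𝓝[>] (0 : ℝ), l ∈ {l : ℝ | |l| ≤ ε ^ (-δ)} := by
      have h1 := ((rpow_tendsto_zero hδ0).mul_const |l|).eventually
        (gt_mem_nhds (show 0 * |l| < 1 by simp))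
      filter_upwards [h1, self_mem_nhdsWithin] with ε hε hpos
      have hpos : 0 < ε := hpos
      change |l| ≤ ε ^ (-δ)
      rw [Real.rpow_neg hpos.le, ← one_div, le_div_iff₀ (by positivity)]
      linarith
    have hlim : Tendsto (fun ε : ℝ => (mittagLeffler β
              (-(μ * |l| ^ α * (1 + l ^ 2 * ε ^ (2 * β / α)) ^ (γ / 2) * t ^ β))) ^ 2 *
            specDensity n w κ A (ε ^ (β / α) * l)) (𝓝[>] (0 : ℝ))
        (𝓝 ((mittagLeffler β (-(μ * |l| ^ α * t ^ β))) ^ 2 * specDensityZero n w κ A)) := by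
      refine Tendsto.mul ?_ ?_
      · have hg : Continuous fun e : ℝ => (mittagLeffler β
              (-(μ * |l| ^ α * (1 + l ^ 2 * e) ^ (γ / 2) * t ^ β))) ^ 2 := by
          have hpw : Continuous fun e : ℝ => (1 + l ^ 2 * e) ^ (γ / 2) :=
            Continuous.rpow_const (by fun_prop) fun _ => Or.inr (by positivity)
          fun_prop
        have h1 := (hg.tendsto 0).comp
          (rpow_tendsto_zero (show 0 < 2 * β / α by positivity))
        simpa [Function.comp_def] using h1
      · have h1 := (rpow_tendsto_zero (show 0 < β / α by positivity)).mul_const l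
        rw [zero_mul] at h1
        have h2 := (specDensity_continuousAt hκ hA0
          (hball (Metric.mem_closedBall_self hr.le))).tendsto.comp h1
        rwa [specDensity_zero hw hA0] at h2
    rw [mul_comm (specDensityZero n w κ A)]
    refine hlim.congr' ?_
    filter_upwards [hmem] with ε hε
    rw [Set.indicator_of_mem (show l ∈ {l : ℝ | |l| ≤ ε ^ (-δ)} from hε)]
end

section
/- Assume A_0 = 0, α > 1/2, β ∈ (0,1), γ > 0, μ > 0, t > 0, and let δ ∈ (β/(2α²), β/α). Then lim_{ε→0⁺} ∫_{|λ| > ε^{−δ}} E_β²(−μ|λ|^α (1 + λ² ε^{2β/α})^{γ/2} t^β) f(ε^{β/α} λ) dλ = 0. -/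
open Real Filter Topology MeasureTheory

lemma aux_laplace (a : ℝ) (ha : 1 < a) (p : ℂ) (hp : 0 < p.re) :
    ∫ x in Set.Ioi (0:ℝ), ((x ^ (a-1) : ℝ) : ℂ) * Complex.exp (-p * x)
      = Real.Gamma a * p ^ (-a : ℂ) := by
  set U : Set ℂ := {p : ℂ | 0 < p.re} with hU
  have hUo : IsOpen U := isOpen_lt continuous_const Complex.continuous_re
  have hUc : IsPreconnected U := (convex_halfSpace_re_gt 0).isPreconnected
  have hmeas : ∀ (b : ℝ) (q : ℂ), AEStronglyMeasurable
      (fun x : ℝ => ((x ^ b : ℝ) : ℂ) * Complex.exp (-q * x)) (volume.restrict (Set.Ioi 0)) := by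
    intro b q
    apply Measurable.aestronglyMeasurable
    fun_prop
  have hint : ∀ (b : ℝ), -1 < b → ∀ r : ℝ, 0 < r → IntegrableOn
      (fun x : ℝ => x ^ b * Real.exp (-r * x)) (Set.Ioi 0) := by
    intro b hb r hr
    have := integrableOn_rpow_mul_exp_neg_mul_rpow (p := 1) hb one_pos hr
    simpa using this
  have hnorm : ∀ (b : ℝ) (q : ℂ) (x : ℝ), 0 < x →
      ‖((x ^ b : ℝ) : ℂ) * Complex.exp (-q * x)‖ = x ^ b * Real.exp (-q.re * x) := by
    intro b q x hx
    rw [norm_mul, Complex.norm_exp, Complex.norm_real, Real.norm_of_nonneg (by positivity)]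
    simp
  have hL : DifferentiableOn ℂ (fun p : ℂ => ∫ x in Set.Ioi (0:ℝ),
      ((x ^ (a-1) : ℝ) : ℂ) * Complex.exp (-p * x)) U := by
    intro q hq
    have hq' : 0 < q.re := hq
    have hs : {z : ℂ | q.re / 2 < z.re} ∈ 𝓝 q :=
      (isOpen_lt continuous_const Complex.continuous_re).mem_nhds (by simp; linarith)
    refine (hasDerivAt_integral_of_dominated_loc_of_deriv_le (𝕜 := ℂ)
      (F := fun p x => ((x ^ (a-1) : ℝ) : ℂ) * Complex.exp (-p * x))
      (F' := fun p x => ((x ^ (a-1) : ℝ) : ℂ) * (Complex.exp (-p * x) * (-x)))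
      (bound := fun x => x ^ a * Real.exp (-(q.re/2) * x)) hs ?_ ?_ ?_ ?_ ?_ ?_).2.differentiableAt.differentiableWithinAt
    · exact Eventually.of_forall fun z => hmeas _ z
    · rw [← integrable_norm_iff (hmeas _ q)]
      refine (hint (a-1) (by linarith) q.re hq').congr ?_
      filter_upwards [self_mem_ae_restrict measurableSet_Ioi] with x hx
      rw [hnorm _ _ _ hx]
    · apply Measurable.aestronglyMeasurable
      fun_prop
    · filter_upwards [self_mem_ae_restrict measurableSet_Ioi] with x hx z hz
      have hx0 : 0 < x := hx
      rw [← mul_assoc, norm_mul, hnorm _ _ _ hx]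
      have : ‖-(x:ℂ)‖ = x := by simp [abs_of_pos hx0]
      rw [this]
      have e1 : x ^ a = x ^ (a-1) * x := by
        rw [← Real.rpow_add_one hx0.ne']; ring_nf
      rw [e1]
      have hz' : q.re / 2 < z.re := hz
      have : Real.exp (-z.re * x) ≤ Real.exp (-(q.re/2) * x) := by
        apply Real.exp_le_exp.mpr; nlinarith
      have hp : 0 ≤ x ^ (a-1) * x := by positivity
      nlinarith
    · exact hint a (by linarith) _ (by linarith)
    · filter_upwards with x z hz
      apply HasDerivAt.const_mul
      have : HasDerivAt (fun z : ℂ => -z * x) (-x) z := by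
        simpa using ((hasDerivAt_id z).neg.mul_const (x:ℂ))
      exact this.cexp
  have hR : DifferentiableOn ℂ (fun p : ℂ => Real.Gamma a * p ^ (-a : ℂ)) U := by
    intro q hq
    apply DifferentiableAt.differentiableWithinAt
    apply DifferentiableAt.const_mul
    apply DifferentiableAt.cpow_const differentiableAt_id
    left; exact hq
  have key := (hL.analyticOnNhd hUo).eqOn_of_preconnected_of_frequently_eq
    (hR.analyticOnNhd hUo) hUc (z₀ := 1) (by simp [hU]) ?_
  · exact key hp
  · have hr : ∀ r : ℝ, 0 < r → ∫ x in Set.Ioi (0:ℝ), ((x ^ (a-1) : ℝ) : ℂ) * Complex.exp (-(r:ℂ) * x)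
      = Real.Gamma a * (r:ℂ) ^ (-a : ℂ) := by
      intro r hr
      have := Real.integral_rpow_mul_exp_neg_mul_Ioi (a := a) (r := r) (by linarith) hr
      have h2 : ((r:ℂ) ^ (-a : ℂ)) = ((r ^ (-a) : ℝ) : ℂ) := by
        rw [Complex.ofReal_cpow hr.le]; simp
      rw [h2, ← Complex.ofReal_mul, Real.rpow_neg hr.le, ← Real.inv_rpow hr.le, ← one_div, mul_comm (Real.Gamma a), ← this,
        ← integral_complex_ofReal]
      apply integral_congr_ae
      filter_upwards with x
      push_cast
      congr 2; ring
    have htend : Tendsto (fun n : ℕ => ((1 + 1 / ((n:ℝ) + 1) : ℝ) : ℂ)) atTop (𝓝[≠] 1) := by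
      rw [tendsto_nhdsWithin_iff]
      constructor
      · have := (tendsto_one_div_add_atTop_nhds_zero_nat (𝕜 := ℝ)).const_add 1
        have h3 := (Complex.continuous_ofReal.tendsto _).comp this
        simpa [Function.comp_def] using h3
      · refine Eventually.of_forall fun n => ?_
        simp only [Set.mem_compl_iff, Set.mem_singleton_iff]
        have : (0:ℝ) < 1 / ((n:ℝ)+1) := by positivity
        intro h
        have h4 : (1 + 1 / ((n:ℝ) + 1) : ℝ) = 1 := by exact_mod_cast h
        linarith
    refine htend.frequently (Frequently.of_forall fun n => ?_)
    exact hr _ (by positivity)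

lemma aux_normline (σ y r : ℝ) (hσ : 1 ≤ σ) (hr : 0 ≤ r) :
    ‖((σ:ℂ) + y * Complex.I)‖ ^ (-r) ≤ (1 + ‖y‖ ^ 2) ^ (-r / 2) := by
  have h1 : (1 + ‖y‖^2) ^ (-r/2) = (Real.sqrt (1 + ‖y‖^2)) ^ (-r) := by
    rw [Real.sqrt_eq_rpow, ← Real.rpow_mul (by positivity)]; congr 1; ring
  rw [h1]
  apply Real.rpow_le_rpow_of_nonpos (by positivity) _ (by linarith)
  rw [Complex.norm_add_mul_I]
  apply Real.sqrt_le_sqrt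
  rw [Real.norm_eq_abs, sq_abs]
  nlinarith

lemma aux_japan (r : ℝ) (hr : 1 < r) : Integrable (fun y : ℝ => (1 + ‖y‖ ^ 2) ^ (-r / 2)) := by
  apply integrable_rpow_neg_one_add_norm_sq
  simpa using hr

lemma aux_line_ne (σ y : ℝ) (hσ : 1 ≤ σ) : ((σ:ℂ) + y * Complex.I) ∈ Complex.slitPlane := by
  left; simp; linarith

lemma aux_normcpow (p : ℂ) (_hp : p ≠ 0) (a : ℝ) : ‖p ^ (-a : ℂ)‖ = ‖p‖ ^ (-a) := by
  have := Complex.norm_cpow_real p (-a)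
  push_cast at this
  exact this

lemma aux_cont (σ a : ℝ) (hσ : 1 ≤ σ) :
    Continuous (fun y : ℝ => ((σ:ℂ) + y * Complex.I) ^ (-a : ℂ)) := by
  apply Continuous.cpow (by fun_prop) (by fun_prop)
  intro y; exact aux_line_ne σ y hσ

lemma aux_int (σ a : ℝ) (hσ : 1 ≤ σ) (ha : 1 < a) :
    Integrable (fun y : ℝ => ((σ:ℂ) + y * Complex.I) ^ (-a : ℂ)) := by
  refine (aux_japan a ha).mono' (aux_cont σ a hσ).aestronglyMeasurable ?_
  filter_upwards with y
  rw [aux_normcpow _ (Complex.slitPlane_ne_zero (aux_line_ne σ y hσ))]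
  exact aux_normline σ y a hσ (by linarith)

open FourierTransform in
lemma aux_gammainv (σ a : ℝ) (hσ : 1 ≤ σ) (ha : 1 < a) :
    ∫ y : ℝ, Complex.exp ((σ:ℂ) + y * Complex.I) * ((σ:ℂ) + y * Complex.I) ^ (-a : ℂ)
      = 2 * π / Real.Gamma a := by
  set f : ℝ → ℂ := Set.indicator (Set.Ioi 0)
    (fun x : ℝ => ((x ^ (a-1) : ℝ) : ℂ) * Complex.exp (-(σ:ℂ) * x)) with hf
  have hG : 0 < Real.Gamma a := Real.Gamma_pos_of_pos (by linarith)
  have hF : ∀ ξ : ℝ, 𝓕 f ξ = Real.Gamma a * ((σ:ℂ) + (2 * π * ξ : ℝ) * Complex.I) ^ (-a : ℂ) := by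
    intro ξ
    rw [Real.fourier_real_eq_integral_exp_smul,
      ← aux_laplace a ha ((σ:ℂ) + (2 * π * ξ : ℝ) * Complex.I) (by simp; linarith),
      ← integral_indicator measurableSet_Ioi]
    congr 1
    ext x
    by_cases hx : x ∈ Set.Ioi (0:ℝ)
    · rw [Set.indicator_of_mem hx, hf, Set.indicator_of_mem hx, smul_eq_mul, mul_left_comm,
        ← Complex.exp_add]
      congr 2
      push_cast; ring
    · rw [Set.indicator_of_notMem hx, hf, Set.indicator_of_notMem hx, smul_zero]
  have hfi : Integrable f := by
    rw [hf, integrable_indicator_iff measurableSet_Ioi]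
    have := integrableOn_rpow_mul_exp_neg_mul_rpow (p := 1) (s := a - 1) (b := σ) (by linarith) one_pos (by linarith)
    refine Integrable.mono' this ?_ ?_
    · apply Measurable.aestronglyMeasurable
      fun_prop
    · filter_upwards [self_mem_ae_restrict measurableSet_Ioi] with x hx
      have hx0 : 0 < x := hx
      rw [norm_mul, Complex.norm_exp, Complex.norm_real, Real.norm_of_nonneg (by positivity)]
      simp
  have hFi : Integrable (𝓕 f) := by
    have := ((aux_int σ a hσ ha).comp_mul_left' (R := 2 * π) (by positivity)).const_mul (Real.Gamma a : ℂ)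
    refine this.congr (Eventually.of_forall fun ξ => ?_)
    simp only [hF ξ]
  have hc : ContinuousAt f 1 := by
    have : f =ᶠ[𝓝 1] (fun x : ℝ => ((x ^ (a-1) : ℝ) : ℂ) * Complex.exp (-(σ:ℂ) * x)) := by
      filter_upwards [Ioi_mem_nhds (show (0:ℝ) < 1 by norm_num)] with x hx
      rw [hf, Set.indicator_of_mem hx]
    refine ContinuousAt.congr ?_ this.symm
    apply ContinuousAt.mul
    · apply Complex.continuous_ofReal.continuousAt.comp
      exact Real.continuousAt_rpow_const _ _ (by norm_num)
    · fun_prop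
  have inv := hfi.fourierInv_fourier_eq hFi hc
  rw [Real.fourierInv_eq'] at inv
  have f1 : f 1 = Complex.exp (-(σ:ℂ)) := by
    rw [hf, Set.indicator_of_mem (by norm_num)]; simp
  rw [f1] at inv
  have h2 := Measure.integral_comp_mul_left (fun y : ℝ => Complex.exp ((σ:ℂ) + y * Complex.I) * ((σ:ℂ) + y * Complex.I) ^ (-a : ℂ)) (2 * π)
  have h3 : ∫ ξ : ℝ, Complex.exp ((σ:ℂ) + ((2*π*ξ : ℝ):ℂ) * Complex.I) * ((σ:ℂ) + ((2*π*ξ : ℝ):ℂ) * Complex.I) ^ (-a : ℂ) = 1 / Real.Gamma a := by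
    have : ∀ ξ : ℝ, Complex.exp ((σ:ℂ) + ((2*π*ξ : ℝ):ℂ) * Complex.I) * ((σ:ℂ) + ((2*π*ξ : ℝ):ℂ) * Complex.I) ^ (-a : ℂ)
        = (Complex.exp σ / Real.Gamma a) * (Complex.exp (((2 * π * inner ℝ ξ (1:ℝ) : ℝ) : ℂ) * Complex.I) • 𝓕 f ξ) := by
      intro ξ
      rw [hF ξ, Complex.exp_add]
      have : (Real.Gamma a : ℂ) ≠ 0 := by exact_mod_cast hG.ne'
      simp only [smul_eq_mul]
      have e : (inner ℝ ξ (1:ℝ) : ℝ) = ξ := by simp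
      rw [e]
      field_simp
    simp_rw [this]
    rw [integral_const_mul, inv, div_mul_eq_mul_div, ← Complex.exp_add]
    simp
  rw [h3] at h2
  rw [abs_of_pos (by positivity)] at h2
  have hpi : (π:ℂ) ≠ 0 := by exact_mod_cast Real.pi_ne_zero
  rw [Complex.real_smul] at h2
  push_cast at h2
  have : ∀ I : ℂ, 1 / (Real.Gamma a : ℂ) = (2 * (π:ℂ))⁻¹ * I → I = 2 * π / Real.Gamma a := by
    intro I h
    have : I = (2 * π) * ((2 * (π:ℂ))⁻¹ * I) := by field_simp
    rw [this, ← h]; ring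
  exact this _ h2

lemma aux_shift (F : ℂ → ℂ) (hF : DifferentiableOn ℂ F {p : ℂ | 0 < p.re}) (C r σ : ℝ)
    (hr : 1 < r) (hσ : 1 ≤ σ)
    (hb : ∀ x y : ℝ, 1 ≤ x → x ≤ σ → ‖F (x + y * Complex.I)‖ ≤ C * (1 + ‖y‖^2) ^ (-r/2)) :
    ∫ y : ℝ, F ((1:ℝ) + y * Complex.I) = ∫ y : ℝ, F (σ + y * Complex.I) := by
  have hcont : ∀ x : ℝ, 1 ≤ x → Continuous (fun y : ℝ => F (x + y * Complex.I)) := by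
    intro x hx
    apply hF.continuousOn.comp_continuous (by fun_prop)
    intro y; simp; linarith
  have hi : ∀ x : ℝ, 1 ≤ x → x ≤ σ → Integrable (fun y : ℝ => F (x + y * Complex.I)) := by
    intro x hx hx'
    refine ((aux_japan r hr).const_mul C).mono' (hcont x hx).aestronglyMeasurable ?_
    filter_upwards with y using hb x y hx hx'
  have t1 := intervalIntegral_tendsto_integral (hi 1 le_rfl hσ) tendsto_neg_atTop_atBot tendsto_id
  have t2 := intervalIntegral_tendsto_integral (hi σ hσ le_rfl) tendsto_neg_atTop_atBot tendsto_id
  have hdec : Tendsto (fun T : ℝ => C * (1 + ‖T‖^2) ^ (-r/2) * |σ - 1|) atTop (𝓝 0) := by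
    have h1 : Tendsto (fun T : ℝ => 1 + ‖T‖^2) atTop atTop := by
      apply tendsto_atTop_add_const_left
      simp only [Real.norm_eq_abs, sq_abs]
      exact tendsto_pow_atTop (by norm_num)
    have h2 := (tendsto_rpow_neg_atTop (y := r/2) (by linarith)).comp h1
    have h3 := (h2.const_mul C).mul_const (|σ - 1|)
    simp only [mul_zero, zero_mul] at h3
    refine h3.congr fun T => ?_
    simp only [Function.comp]
    rw [neg_div]
  have bnd : ∀ T : ℝ, ‖∫ x in (1:ℝ)..σ, F (x + T * Complex.I)‖ ≤ C * (1 + ‖T‖^2) ^ (-r/2) * |σ - 1| := by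
    intro T
    apply intervalIntegral.norm_integral_le_of_norm_le_const
    intro x hx
    rw [Set.uIoc_of_le hσ] at hx
    exact hb x T hx.1.le hx.2
  have h1 : Tendsto (fun T : ℝ => ∫ x in (1:ℝ)..σ, F (x + T * Complex.I)) atTop (𝓝 0) :=
    squeeze_zero_norm bnd hdec
  have h2 : Tendsto (fun T : ℝ => ∫ x in (1:ℝ)..σ, F (x + ((-T : ℝ):ℂ) * Complex.I)) atTop (𝓝 0) := by
    refine squeeze_zero_norm (fun T => ?_) hdec
    have := bnd (-T)
    rwa [norm_neg] at this
  have rect : ∀ T : ℝ, (((∫ x in (1:ℝ)..σ, F (x + ((-T:ℝ):ℂ) * Complex.I)) -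
      ∫ x in (1:ℝ)..σ, F (x + T * Complex.I)) + Complex.I • ∫ y in (-T)..T, F (σ + y * Complex.I)) -
      Complex.I • ∫ y in (-T)..T, F ((1:ℝ) + y * Complex.I) = 0 := by
    intro T
    have := Complex.integral_boundary_rect_eq_zero_of_differentiableOn F (⟨1, -T⟩ : ℂ) (⟨σ, T⟩ : ℂ) ?_
    · exact this
    · apply hF.mono
      intro z hz
      have h := (Complex.mem_reProdIm.mp hz).1
      simp only [Set.uIcc_of_le hσ] at h
      have := h.1
      show 0 < z.re
      linarith
  have lim := (((h2.sub h1).add (t2.const_smul Complex.I)).sub (t1.const_smul Complex.I))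
  have lim0 := tendsto_nhds_unique (lim.congr rect) tendsto_const_nhds
  simp only [sub_zero, zero_add, smul_eq_mul] at lim0
  have h5 := mul_left_cancel₀ Complex.I_ne_zero (sub_eq_zero.mp lim0)
  exact h5.symm

lemma aux_re_pos (β : ℝ) (hβ0 : 0 < β) (hβ1 : β < 1) (p : ℂ) (hp : 0 < p.re) :
    0 < (p ^ (-β : ℂ)).re := by
  have hp0 : p ≠ 0 := by rintro rfl; simp at hp
  have hn : 0 < ‖p‖ := norm_pos_iff.mpr hp0
  have harg : |p.arg| < π / 2 := by
    rw [Complex.abs_arg_lt_pi_div_two_iff]; left; exact hp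
  rw [Complex.cpow_def_of_ne_zero hp0, Complex.exp_re]
  apply mul_pos (Real.exp_pos _)
  apply Real.cos_pos_of_mem_Ioo
  have : (Complex.log p * (-β : ℂ)).im = - β * p.arg := by
    simp [Complex.log_im, mul_comm]
  rw [this]
  rw [abs_lt] at harg
  constructor <;> nlinarith [Real.pi_pos, harg.1, harg.2]

noncomputable def auxG (β s : ℝ) (p : ℂ) : ℂ :=
  Complex.exp p * (p ^ (-2 : ℂ) * ((1 + (1 - β) * (s * p ^ (-β : ℂ))) / (1 + s * p ^ (-β : ℂ)) ^ 2))

lemma auxG_bound (β s : ℝ) (hβ0 : 0 < β) (hβ1 : β < 1) (hs : 0 < s) (p : ℂ) (hp : 0 < p.re) :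
    ‖auxG β s p‖ ≤ Real.exp p.re * (2 / s) * ‖p‖ ^ (-(2 - β)) := by
  have hp0 : p ≠ 0 := by rintro rfl; simp at hp
  have hn : 0 < ‖p‖ := norm_pos_iff.mpr hp0
  have hz := aux_re_pos β hβ0 hβ1 p hp
  have hzn := aux_normcpow p hp0 β
  have h2n := aux_normcpow p hp0 2
  push_cast at h2n
  set z := p ^ (-β : ℂ) with hzdef
  have hsre : ((s:ℂ) * z).re = s * z.re := by simp
  have hw1 : 1 ≤ ‖1 + (s:ℂ) * z‖ := by
    refine le_trans ?_ (Complex.re_le_norm _)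
    simp; positivity
  have hw2 : ‖(s:ℂ) * z‖ ≤ ‖1 + (s:ℂ) * z‖ := by
    rw [← sq_le_sq₀ (norm_nonneg _) (norm_nonneg _), Complex.sq_norm, Complex.sq_norm,
      Complex.normSq_apply, Complex.normSq_apply]
    simp
    nlinarith [mul_pos hs hz]
  have hsz : ‖(s:ℂ) * z‖ = s * ‖p‖ ^ (-β) := by
    rw [norm_mul, hzn, Complex.norm_real, Real.norm_of_nonneg hs.le]
  have hszpos : 0 < ‖(s:ℂ) * z‖ := by rw [hsz]; positivity
  have hnum : ‖1 + (1 - (β:ℂ)) * (s * z)‖ ≤ 1 + ‖(s:ℂ) * z‖ := by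
    refine (norm_add_le _ _).trans ?_
    rw [norm_mul, norm_one]
    have : ‖(1 - (β:ℂ))‖ ≤ 1 := by
      rw [← Complex.ofReal_one, ← Complex.ofReal_sub, Complex.norm_real, Real.norm_of_nonneg (by linarith)]
      linarith
    nlinarith
  have hq : ‖(1 + (1 - (β:ℂ)) * (s * z)) / (1 + s * z) ^ 2‖ ≤ 2 / ‖(s:ℂ) * z‖ := by
    rw [norm_div, norm_pow, div_le_div_iff₀ (by positivity) hszpos]
    nlinarith
  unfold auxG
  rw [norm_mul, norm_mul, Complex.norm_exp, h2n]
  calc Real.exp p.re * (‖p‖ ^ (-(2:ℝ)) * ‖(1 + (1 - (β:ℂ)) * (s * z)) / (1 + s * z) ^ 2‖)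
      ≤ Real.exp p.re * (‖p‖ ^ (-(2:ℝ)) * (2 / ‖(s:ℂ) * z‖)) := by gcongr
    _ = _ := by
      rw [hsz, show (-(2 - β)) = -2 + β by ring, Real.rpow_add hn, Real.rpow_neg hn.le β]
      field_simp

lemma auxG_diff (β s : ℝ) (hβ0 : 0 < β) (hβ1 : β < 1) (hs : 0 < s) :
    DifferentiableOn ℂ (auxG β s) {p : ℂ | 0 < p.re} := by
  intro p hp
  have hp' : 0 < p.re := hp
  have hz := aux_re_pos β hβ0 hβ1 p hp
  have hne : (1 + s * p ^ (-β : ℂ)) ^ 2 ≠ 0 := by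
    apply pow_ne_zero
    intro h
    have := congrArg Complex.re h
    simp at this
    nlinarith [mul_pos hs hz]
  have hd : ∀ c : ℂ, DifferentiableAt ℂ (fun p : ℂ => p ^ c) p := fun c =>
    DifferentiableAt.cpow_const differentiableAt_id (Or.inl hp')
  apply DifferentiableAt.differentiableWithinAt
  unfold auxG
  refine Complex.differentiable_exp.differentiableAt.mul ((hd _).mul (DifferentiableAt.div ?_ ?_ hne))
  · exact (((hd _).const_mul _).const_mul _).const_add _
  · exact (((hd _).const_mul _).const_add _).pow 2

lemma aux_geom (β : ℝ) (q : ℂ) (hq : ‖q‖ < 1) :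
    ∑' k : ℕ, ((β:ℂ) * k + 1) * q ^ k = (1 - (1 - β) * q) / (1 - q) ^ 2 := by
  have h1 := (hasSum_coe_mul_geometric_of_norm_lt_one hq).mul_left (β:ℂ)
  have h2 := hasSum_geometric_of_norm_lt_one hq
  have hne : 1 - q ≠ 0 := by
    intro h
    have : q = 1 := (sub_eq_zero.mp h).symm
    rw [this] at hq; simp at hq
  have h3 := (h1.add h2).tsum_eq
  have e : ∀ k : ℕ, ((β:ℂ) * k + 1) * q ^ k = β * (k * q ^ k) + q ^ k := fun k => by ring
  simp_rw [e]
  rw [h3]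
  field_simp
  ring

lemma aux_sum (β s σ : ℝ) (hβ0 : 0 < β) (hβ1 : β < 1) (hs : 0 < s) (hσ : 1 ≤ σ)
    (hsσ : s * σ ^ (-β) ≤ 1 / 2) :
    ∫ y : ℝ, auxG β s (σ + y * Complex.I) = 2 * π * (mittagLeffler β (-s) : ℂ) := by
  set F : ℕ → ℝ → ℂ := fun k y => ((-s : ℂ) ^ k * (β * k + 1)) *
    (Complex.exp ((σ:ℂ) + y * Complex.I) * ((σ:ℂ) + y * Complex.I) ^ (-((β * k + 2 : ℝ)) : ℂ)) with hFdef
  have hk1 : ∀ k : ℕ, 1 < β * k + 2 := fun k => by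
    have : 0 ≤ β * k := by positivity
    linarith
  have hFnorm : ∀ k y, ‖F k y‖ ≤ (Real.exp σ * ((k + 1) * (1/2) ^ k)) * (1 + ‖y‖ ^ 2) ^ (-(2:ℝ) / 2) := by
    intro k y
    have hp0 := Complex.slitPlane_ne_zero (aux_line_ne σ y hσ)
    have hσp : σ ≤ ‖((σ:ℂ) + y * Complex.I)‖ := by
      refine le_trans ?_ (Complex.re_le_norm _)
      simp
    have hbr := aux_normline σ y 2 hσ (by norm_num)
    have hn : 0 < ‖((σ:ℂ) + y * Complex.I)‖ := norm_pos_iff.mpr hp0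
    simp only [hFdef]
    rw [norm_mul, norm_mul, norm_mul, Complex.norm_exp, aux_normcpow _ hp0]
    have e1 : (((σ:ℂ) + y * Complex.I)).re = σ := by simp
    rw [e1]
    have e2 : ‖((-s:ℂ)) ^ k‖ = s ^ k := by
      rw [norm_pow, norm_neg, Complex.norm_real, Real.norm_of_nonneg hs.le]
    have e3 : ‖((β:ℂ) * k + 1)‖ ≤ k + 1 := by
      have : ((β:ℂ) * k + 1) = ((β * k + 1 : ℝ) : ℂ) := by push_cast; ring
      rw [this, Complex.norm_real, Real.norm_of_nonneg (by positivity)]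
      have : β * k ≤ 1 * k := by gcongr
      linarith
    have e4 : ‖((σ:ℂ) + y * Complex.I)‖ ^ (-(β * k + 2)) = (‖((σ:ℂ) + y * Complex.I)‖ ^ (-β)) ^ k * ‖((σ:ℂ) + y * Complex.I)‖ ^ (-(2:ℝ)) := by
      rw [← Real.rpow_natCast, ← Real.rpow_mul hn.le, ← Real.rpow_add hn]; congr 1; ring
    have e5 : ‖((σ:ℂ) + y * Complex.I)‖ ^ (-β) ≤ σ ^ (-β) :=
      Real.rpow_le_rpow_of_nonpos (by linarith) hσp (by linarith)
    have e6 : s ^ k * (‖((σ:ℂ) + y * Complex.I)‖ ^ (-β)) ^ k ≤ (1/2) ^ k := by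
      rw [← mul_pow]
      apply pow_le_pow_left₀ (by positivity)
      refine le_trans ?_ hsσ
      gcongr
    rw [e2, e4]
    calc s ^ k * ‖((β:ℂ) * k + 1)‖ * (Real.exp σ * ((‖((σ:ℂ) + y * Complex.I)‖ ^ (-β)) ^ k * ‖((σ:ℂ) + y * Complex.I)‖ ^ (-(2:ℝ))))
        = Real.exp σ * (‖((β:ℂ) * k + 1)‖ * (s ^ k * (‖((σ:ℂ) + y * Complex.I)‖ ^ (-β)) ^ k)) * ‖((σ:ℂ) + y * Complex.I)‖ ^ (-(2:ℝ)) := by ring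
      _ ≤ _ := by gcongr
  have hFi : ∀ k, Integrable (F k) := by
    intro k
    refine ((aux_japan 2 (by norm_num)).const_mul _).mono' ?_ (Eventually.of_forall (hFnorm k))
    apply Continuous.aestronglyMeasurable
    refine continuous_const.mul (Continuous.mul (by fun_prop) (aux_cont σ _ hσ))
  have hsum : Summable fun k : ℕ => ∫ y, ‖F k y‖ := by
    have hs1 : Summable (fun k : ℕ => ((k:ℝ) + 1) * (1/2 : ℝ)^k) := by
      have h1 := (hasSum_coe_mul_geometric_of_norm_lt_one (r := (1/2 : ℝ)) (by norm_num)).summable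
      have h2 := summable_geometric_of_lt_one (r := (1/2 : ℝ)) (by norm_num) (by norm_num)
      refine (h1.add h2).congr fun k => by ring
    refine Summable.of_nonneg_of_le (fun k => integral_nonneg fun y => norm_nonneg _) (fun k => ?_)
      ((hs1.mul_left (Real.exp σ)).mul_right (∫ y : ℝ, (1 + ‖y‖ ^ 2) ^ (-(2:ℝ) / 2)))
    rw [← integral_const_mul]
    exact integral_mono (hFi k).norm ((aux_japan 2 (by norm_num)).const_mul _) (hFnorm k)
  have H := hasSum_integral_of_summable_integral_norm hFi hsum
  have hterm : ∀ k, ∫ y, F k y = 2 * π * (((-s) ^ k / Real.Gamma (1 + β * k) : ℝ) : ℂ) := by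
    intro k
    simp only [hFdef]
    rw [integral_const_mul, aux_gammainv σ _ hσ (hk1 k)]
    have hpos : (0:ℝ) < 1 + β * k := by positivity
    have hG := Real.Gamma_pos_of_pos hpos
    have hGe : Real.Gamma (β * k + 2) = (1 + β * k) * Real.Gamma (1 + β * k) := by
      rw [← Real.Gamma_add_one hpos.ne']; congr 1; ring
    rw [hGe]
    push_cast
    have a1 : (1 + (β:ℂ) * k) ≠ 0 := by exact_mod_cast hpos.ne'
    have a2 : (Real.Gamma (1 + β * k) : ℂ) ≠ 0 := by exact_mod_cast hG.ne'
    field_simp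
    ring
  have hpt : ∀ y : ℝ, ∑' k, F k y = auxG β s (σ + y * Complex.I) := by
    intro y
    have hp0 := Complex.slitPlane_ne_zero (aux_line_ne σ y hσ)
    have hσp : σ ≤ ‖((σ:ℂ) + y * Complex.I)‖ := by
      refine le_trans ?_ (Complex.re_le_norm _)
      simp
    set p := ((σ:ℂ) + y * Complex.I) with hp
    have hz : ‖-((s:ℂ) * p ^ (-β:ℂ))‖ < 1 := by
      rw [norm_neg, norm_mul, aux_normcpow p hp0, Complex.norm_real, Real.norm_of_nonneg hs.le]
      have e5 : ‖p‖ ^ (-β) ≤ σ ^ (-β) :=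
        Real.rpow_le_rpow_of_nonpos (by linarith) hσp (by linarith)
      nlinarith
    have e : ∀ k : ℕ, F k y = (Complex.exp p * p ^ (-2:ℂ)) * (((β:ℂ) * k + 1) * (-((s:ℂ) * p ^ (-β:ℂ))) ^ k) := by
      intro k
      simp only [hFdef]
      rw [← hp]
      have : p ^ (-((β * k + 2 : ℝ)) : ℂ) = p ^ (-2:ℂ) * (p ^ (-β:ℂ)) ^ k := by
        rw [← Complex.cpow_nat_mul, ← Complex.cpow_add _ _ hp0]
        congr 1; push_cast; ring
      rw [this, neg_pow ((s:ℂ) * _), mul_pow, neg_pow (s:ℂ)]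
      ring
    simp_rw [e]
    rw [tsum_mul_left, aux_geom β _ hz]
    unfold auxG
    rw [mul_neg, sub_neg_eq_add, sub_neg_eq_add]
    ring
  simp_rw [hpt] at H
  rw [← H.tsum_eq]
  simp_rw [hterm]
  rw [tsum_mul_left]
  unfold mittagLeffler
  rw [Complex.ofReal_tsum]

lemma ml_bound_s12 (β : ℝ) (hβ0 : 0 < β) (hβ1 : β < 1) :
    ∃ C : ℝ, 0 ≤ C ∧ ∀ s : ℝ, 0 < s → |mittagLeffler β (-s)| ≤ C / s := by
  set J := ∫ y : ℝ, (1 + ‖y‖ ^ 2) ^ (-(2 - β) / 2) with hJ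
  have hJ0 : 0 ≤ J := integral_nonneg fun y => by positivity
  refine ⟨Real.exp 1 * 2 * J / (2 * π), by positivity, fun s hs => ?_⟩
  obtain ⟨σ, hσ, hsσ⟩ : ∃ σ : ℝ, 1 ≤ σ ∧ s * σ ^ (-β) ≤ 1/2 := by
    have h1 := (tendsto_rpow_neg_atTop hβ0).const_mul s
    rw [mul_zero] at h1
    have h2 := (h1.eventually (ge_mem_nhds (show (0:ℝ) < 1/2 by norm_num))).and (eventually_ge_atTop 1)
    obtain ⟨σ, h3, h4⟩ := h2.exists
    exact ⟨σ, h4, h3⟩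
  have hb : ∀ x y : ℝ, 1 ≤ x → ‖auxG β s (x + y * Complex.I)‖ ≤ Real.exp x * (2 / s) * (1 + ‖y‖^2) ^ (-(2 - β)/2) := by
    intro x y hx
    refine (auxG_bound β s hβ0 hβ1 hs _ (by simp; linarith)).trans ?_
    have e1 : (((x:ℂ) + y * Complex.I)).re = x := by simp
    rw [e1]
    have := aux_normline x y (2 - β) hx (by linarith)
    gcongr
  have sh := aux_shift (auxG β s) (auxG_diff β s hβ0 hβ1 hs) (Real.exp σ * (2/s)) (2 - β) σ (by linarith) hσ
    (fun x y hx hx' => (hb x y hx).trans (by gcongr))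
  rw [aux_sum β s σ hβ0 hβ1 hs hσ hsσ] at sh
  have hn := norm_integral_le_of_norm_le (f := fun y : ℝ => auxG β s ((1:ℝ) + y * Complex.I)) ((aux_japan (2 - β) (by linarith)).const_mul (Real.exp 1 * (2 / s)))
    (Eventually.of_forall fun y => hb 1 y le_rfl)
  rw [sh, integral_const_mul, ← hJ, norm_mul, norm_mul, Complex.norm_real, Complex.norm_real] at hn
  simp only [Complex.norm_ofNat, Real.norm_eq_abs, abs_of_pos Real.pi_pos] at hn
  rw [div_div, le_div_iff₀ (by positivity)]
  calc _ = (2 * π * |mittagLeffler β (-s)|) * s := by ring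
    _ ≤ (Real.exp 1 * (2/s) * J) * s := by gcongr
    _ = _ := by field_simp

lemma aux_comp_abs (g : ℝ → ℝ) (hg : IntegrableOn g (Set.Ioi 0)) : Integrable (fun x => g |x|) := by
  have hpos : IntegrableOn (fun x => g |x|) (Set.Ioi 0) := by
    refine hg.congr_fun (fun x hx => ?_) measurableSet_Ioi
    have hx' : 0 < x := hx
    simp only [abs_of_pos hx']
  have hneg : IntegrableOn (fun x => g |x|) (Set.Iic 0) := by
    rw [← Measure.map_neg_eq_self (volume : Measure ℝ)]
    let m : MeasurableEmbedding fun x : ℝ => -x := (Homeomorph.neg ℝ).measurableEmbedding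
    rw [m.integrableOn_map_iff]
    simp_rw [Function.comp_def, abs_neg, Set.neg_preimage, Set.neg_Iic, neg_zero]
    exact Iff.mpr integrableOn_Ici_iff_integrableOn_Ioi hpos
  have := hneg.union hpos
  rwa [Set.Iic_union_Ioi, integrableOn_univ] at this

lemma aux_inner (ν s : ℝ) (hν : -1 < ν) (hs : 0 < s) :
    IntegrableOn (fun x : ℝ => x ^ ν * (s ^ (ν - 1) * Real.exp (-(x / 2) * (s + 1 / s)))) (Set.Ioi 0) ∧
    ∫ x in Set.Ioi (0:ℝ), x ^ ν * (s ^ (ν - 1) * Real.exp (-(x / 2) * (s + 1 / s)))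
      = s ^ (ν - 1) * ((1 / ((s + 1 / s) / 2)) ^ (ν + 1) * Real.Gamma (ν + 1)) := by
  have hc : 0 < (s + 1 / s) / 2 := by positivity
  constructor
  · have := (integrableOn_rpow_mul_exp_neg_mul_rpow (p := 1) hν one_pos hc).const_mul (s ^ (ν - 1))
    refine this.congr (Eventually.of_forall fun x => ?_)
    simp only [Real.rpow_one]
    rw [mul_left_comm]
    congr 3; ring
  · have := Real.integral_rpow_mul_exp_neg_mul_Ioi (a := ν + 1) (by linarith) hc
    rw [← this, ← integral_const_mul]
    apply integral_congr_ae
    filter_upwards with x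
    rw [mul_left_comm]
    congr 3
    · ring
    · ring

lemma aux_bessel (ν : ℝ) (h1 : -1/2 < ν) (h2 : ν < 0) :
    Integrable (fun x : ℝ => besselK ν |x| * |x| ^ ν) := by
  apply aux_comp_abs (fun x => besselK ν x * x ^ ν)
  set f : ℝ × ℝ → ℝ := fun q => q.1 ^ ν * (q.2 ^ (ν - 1) * Real.exp (-(q.1 / 2) * (q.2 + 1 / q.2))) with hf
  have hmeas : Measurable f := by
    rw [hf]; fun_prop
  have hint : Integrable f ((volume.restrict (Set.Ioi 0)).prod (volume.restrict (Set.Ioi 0))) := by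
    rw [integrable_prod_iff' hmeas.aestronglyMeasurable]
    constructor
    · filter_upwards [self_mem_ae_restrict measurableSet_Ioi] with s hs
      exact (aux_inner ν s (by linarith) hs).1
    · have hval : ∀ s ∈ Set.Ioi (0:ℝ), ∫ x in Set.Ioi (0:ℝ), ‖f (x, s)‖ =
          s ^ (ν - 1) * ((1 / ((s + 1 / s) / 2)) ^ (ν + 1) * Real.Gamma (ν + 1)) := by
        intro s hs
        have hs0 : 0 < s := hs
        rw [← (aux_inner ν s (by linarith) hs).2]
        refine setIntegral_congr_fun measurableSet_Ioi (fun x hx => ?_)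
        have hx0 : 0 < x := hx
        simp only [hf]
        rw [Real.norm_of_nonneg (by positivity)]
      have hG : 0 < Real.Gamma (ν + 1) := Real.Gamma_pos_of_pos (by linarith)
      have key : IntegrableOn (fun s : ℝ => s ^ (ν - 1) * ((1 / ((s + 1 / s) / 2)) ^ (ν + 1) * Real.Gamma (ν + 1))) (Set.Ioi 0) := by
        have hm : Measurable (fun s : ℝ => s ^ (ν - 1) * ((1 / ((s + 1 / s) / 2)) ^ (ν + 1) * Real.Gamma (ν + 1))) := by
          fun_prop
        have hK : 0 ≤ (2:ℝ) ^ (ν + 1) * Real.Gamma (ν + 1) := by positivity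
        rw [← Set.Ioc_union_Ioi_eq_Ioi (zero_le_one (α := ℝ))]
        apply IntegrableOn.union
        · have h0 : IntegrableOn (fun s : ℝ => s ^ (2 * ν)) (Set.Ioc 0 1) := by
            rw [← intervalIntegrable_iff_integrableOn_Ioc_of_le zero_le_one]
            exact intervalIntegral.intervalIntegrable_rpow' (by linarith)
          refine (h0.const_mul ((2:ℝ) ^ (ν + 1) * Real.Gamma (ν + 1))).mono' hm.aestronglyMeasurable ?_
          filter_upwards [self_mem_ae_restrict measurableSet_Ioc] with s hs
          have hs0 : 0 < s := hs.1
          rw [Real.norm_of_nonneg (by positivity)]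
          have hle : 1 / ((s + 1 / s) / 2) ≤ 2 * s := by
            rw [div_le_iff₀ (by positivity)]
            field_simp
            nlinarith
          have hle2 : (1 / ((s + 1 / s) / 2)) ^ (ν + 1) ≤ (2 * s) ^ (ν + 1) :=
            Real.rpow_le_rpow (by positivity) hle (by linarith)
          rw [Real.mul_rpow (by norm_num) hs0.le] at hle2
          have e : s ^ (2 * ν) = s ^ (ν - 1) * s ^ (ν + 1) := by
            rw [← Real.rpow_add hs0]; congr 1; ring
          rw [e]
          calc _ ≤ s ^ (ν - 1) * ((2:ℝ) ^ (ν + 1) * s ^ (ν + 1) * Real.Gamma (ν + 1)) := by gcongr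
            _ = _ := by ring
        · have h0 : IntegrableOn (fun s : ℝ => s ^ (-2:ℝ)) (Set.Ioi 1) :=
            integrableOn_Ioi_rpow_of_lt (by norm_num) one_pos
          refine (h0.const_mul ((2:ℝ) ^ (ν + 1) * Real.Gamma (ν + 1))).mono' hm.aestronglyMeasurable ?_
          filter_upwards [self_mem_ae_restrict measurableSet_Ioi] with s hs
          have hs1 : 1 < s := hs
          have hs0 : 0 < s := by linarith
          rw [Real.norm_of_nonneg (by positivity)]
          have hle : 1 / ((s + 1 / s) / 2) ≤ 2 * s⁻¹ := by
            rw [div_le_iff₀ (by positivity)]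
            have : 2 * s⁻¹ * ((s + 1 / s) / 2) = 1 + (s⁻¹) ^ 2 := by field_simp
            rw [this]
            nlinarith [sq_nonneg (s⁻¹)]
          have hle2 : (1 / ((s + 1 / s) / 2)) ^ (ν + 1) ≤ (2 * s⁻¹) ^ (ν + 1) :=
            Real.rpow_le_rpow (by positivity) hle (by linarith)
          rw [Real.mul_rpow (by norm_num) (by positivity), Real.inv_rpow hs0.le, ← Real.rpow_neg hs0.le] at hle2
          have e : s ^ (-2:ℝ) = s ^ (ν - 1) * s ^ (-(ν + 1)) := by
            rw [← Real.rpow_add hs0]; congr 1; ring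
          rw [e]
          calc _ ≤ s ^ (ν - 1) * ((2:ℝ) ^ (ν + 1) * s ^ (-(ν + 1)) * Real.Gamma (ν + 1)) := by gcongr
            _ = _ := by ring
      exact key.congr_fun (fun s hs => (hval s hs).symm) measurableSet_Ioi
  have h3 := hint.integral_prod_left.const_mul (1/2)
  refine h3.congr (Eventually.of_forall fun x => ?_)
  simp only [hf, besselK]
  rw [integral_const_mul]
  ring

lemma aux_spec (n : ℕ) (w κ A : ℕ → ℝ) (hA0 : A 0 = 0)
    (hκ : ∀ j ∈ Finset.range (n + 1), κ j ∈ Set.Ioo (0 : ℝ) 1) :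
    Integrable (specDensity n w κ A) := by
  unfold specDensity
  simp only [hA0, mul_zero, zero_mul, zero_add]
  apply integrable_finsetSum
  intro j hj
  have hj' := hκ j (by simp at hj ⊢; omega)
  have hb := aux_bessel ((κ j - 1) / 2) (by linarith [hj'.1]) (by linarith [hj'.2])
  exact ((hb.comp_add_right (w j)).add (hb.comp_sub_right (w j))).const_mul _

theorem outer_region_limit (n : ℕ) (hn : 1 ≤ n) (w κ A : ℕ → ℝ)
    (hw0 : w 0 = 0) (hw : ∀ j ∈ Finset.Icc 1 n, 0 < w j)
    (hκ : ∀ j ∈ Finset.range (n + 1), κ j ∈ Set.Ioo (0 : ℝ) 1)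
    (hA : ∀ j ∈ Finset.range (n + 1), 0 ≤ A j)
    (hAsum : ∑ j ∈ Finset.range (n + 1), A j = 1) (hA0 : A 0 = 0)
    (β α γ μ t δ : ℝ) (hβ : β ∈ Set.Ioo (0 : ℝ) 1) (hα : 1 / 2 < α) (hγ : 0 < γ)
    (hμ : 0 < μ) (ht : 0 < t) (hδ : δ ∈ Set.Ioo (β / (2 * α ^ 2)) (β / α)) :
    Filter.Tendsto
      (fun ε : ℝ =>
        ∫ lam in {l : ℝ | ε ^ (-δ) < |l|},
          (mittagLeffler β
              (-(μ * |lam| ^ α * (1 + lam ^ 2 * ε ^ (2 * β / α)) ^ (γ / 2) * t ^ β))) ^ 2 *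
            specDensity n w κ A (ε ^ (β / α) * lam))
      (𝓝[>] (0 : ℝ)) (𝓝 0) := by
  obtain ⟨C, hC0, hC⟩ := ml_bound_s12 β hβ.1 hβ.2
  have hβ0 := hβ.1
  have hα0 : 0 < α := by linarith
  have hspec := aux_spec n w κ A hA0 hκ
  set M := ∫ x, ‖specDensity n w κ A x‖ with hM
  set D := (C / (μ * t ^ β)) ^ 2 with hD
  have hδ0 : 0 < δ := lt_trans (by positivity) hδ.1
  have hexp : 0 < 2 * α * δ - β / α := by
    have h := hδ.1
    rw [div_lt_iff₀ (by positivity)] at h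
    rw [sub_pos, div_lt_iff₀ hα0]
    nlinarith
  have hlim : Tendsto (fun ε : ℝ => D * M * ε ^ (2 * α * δ - β / α)) (𝓝[>] 0) (𝓝 0) := by
    have h1 : Tendsto (fun ε : ℝ => ε ^ (2 * α * δ - β / α)) (𝓝[>] 0) (𝓝 0) := by
      have := (Real.continuousAt_rpow_const 0 _ (Or.inr hexp.le)).tendsto
      rw [Real.zero_rpow hexp.ne'] at this
      exact this.mono_left nhdsWithin_le_nhds
    simpa using h1.const_mul (D * M)
  refine squeeze_zero_norm' ?_ hlim
  filter_upwards [self_mem_nhdsWithin] with ε hε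
  have hε0 : 0 < ε := hε
  have hea : 0 < ε ^ (β / α) := by positivity
  have hi : Integrable (fun lam : ℝ => ‖specDensity n w κ A (ε ^ (β / α) * lam)‖) :=
    (hspec.comp_mul_left' hea.ne').norm
  have hi2 := hi.const_mul (D * ε ^ (2 * α * δ))
  have hmS : MeasurableSet {l : ℝ | ε ^ (-δ) < |l|} :=
    measurableSet_lt measurable_const (by fun_prop)
  have hval : ∫ lam : ℝ, ‖specDensity n w κ A (ε ^ (β / α) * lam)‖ = (ε ^ (β / α))⁻¹ * M := by
    rw [Measure.integral_comp_mul_left (fun x => ‖specDensity n w κ A x‖), abs_of_pos (by positivity), smul_eq_mul]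
  calc _ ≤ ∫ lam in {l : ℝ | ε ^ (-δ) < |l|}, (D * ε ^ (2 * α * δ)) * ‖specDensity n w κ A (ε ^ (β / α) * lam)‖ := by
        refine norm_integral_le_of_norm_le hi2.integrableOn ?_
        filter_upwards [self_mem_ae_restrict hmS] with lam hlam
        have hl : ε ^ (-δ) < |lam| := hlam
        have hl0 : 0 < |lam| := lt_trans (by positivity) hl
        rw [norm_mul]
        refine mul_le_mul_of_nonneg_right ?_ (norm_nonneg _)
        have hla : ε ^ (-δ * α) ≤ |lam| ^ α := by
          rw [Real.rpow_mul hε0.le]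
          exact Real.rpow_le_rpow (by positivity) hl.le hα0.le
        have h1 : (1:ℝ) ≤ (1 + lam ^ 2 * ε ^ (2 * β / α)) ^ (γ / 2) := by
          apply Real.one_le_rpow _ (by positivity)
          have : 0 ≤ lam ^ 2 * ε ^ (2 * β / α) := by positivity
          linarith
        set s := μ * |lam| ^ α * (1 + lam ^ 2 * ε ^ (2 * β / α)) ^ (γ / 2) * t ^ β with hs
        have hsl : μ * t ^ β * ε ^ (-δ * α) ≤ s := by
          calc μ * t ^ β * ε ^ (-δ * α) ≤ μ * t ^ β * |lam| ^ α := by gcongr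
            _ = μ * |lam| ^ α * 1 * t ^ β := by ring
            _ ≤ s := by rw [hs]; gcongr
        have hs0 : 0 < s := lt_of_lt_of_le (by positivity) hsl
        have hb : |mittagLeffler β (-s)| ≤ C / (μ * t ^ β) * ε ^ (δ * α) := by
          refine (hC s hs0).trans ?_
          calc C / s ≤ C / (μ * t ^ β * ε ^ (-δ * α)) := by gcongr
            _ = _ := by
              rw [neg_mul, Real.rpow_neg hε0.le]; field_simp
        rw [norm_pow, Real.norm_eq_abs]
        calc |mittagLeffler β (-s)| ^ 2 ≤ (C / (μ * t ^ β) * ε ^ (δ * α)) ^ 2 := by gcongr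
          _ = D * ε ^ (2 * α * δ) := by
            rw [mul_pow, ← hD, ← Real.rpow_natCast (ε ^ (δ * α)), ← Real.rpow_mul hε0.le]
            congr 2; push_cast; ring
    _ ≤ ∫ lam : ℝ, (D * ε ^ (2 * α * δ)) * ‖specDensity n w κ A (ε ^ (β / α) * lam)‖ := by
        refine setIntegral_le_integral hi2 (Eventually.of_forall fun x => ?_)
        simp only [Pi.zero_apply]
        positivity
    _ = D * M * ε ^ (2 * α * δ - β / α) := by
        rw [integral_const_mul, hval, Real.rpow_sub hε0]
        field_simp
end
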